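/- arXiv:1502.07656 — 2 statements merged into one kernel-verified Lean document; each statement's English description precedes it below -/
import Mathlib

section
/- For every positive integer p and positive integer m, the following identity of ordinary Schur polynomials holds in ℚ[[x_1,…,x_m]]: (Σ_{ν} s_ν(x_1,…,x_m)) · (Σ_{σ∈P_p} (−1)^{(|σ|−r(σ)(p−1))/2} s_σ(x_1,…,x_m)) = Σ_{λ : λ_1≤p} s_λ(x_1,…,x_m), where the first sum runs over all partitions ν, the second over all partitions σ whose Frobenius arm and leg lengths satisfy a_k = b_k + p for k = 1,…,r(σ), and the right-hand sum over all partitions λ of width at most p. -/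
noncomputable section

/-- A semistandard Young tableau of shape `lam` with entries in `{0,…,m-1}`
(representing the variables `x_1,…,x_m`): entries are `< m` on the cells of
`lam`, rows are weakly increasing, columns are strictly increasing, and the
tableau vanishes outside the shape. -/
def IsSSYT (m : ℕ) (lam : YoungDiagram) (T : ℕ → ℕ → ℕ) : Prop :=
  (∀ i j : ℕ, (i, j) ∈ lam.cells → T i j < m) ∧
  (∀ i j1 j2 : ℕ, j1 ≤ j2 → (i, j1) ∈ lam.cells → (i, j2) ∈ lam.cells →
      T i j1 ≤ T i j2) ∧
  (∀ i1 i2 j : ℕ, i1 < i2 → (i1, j) ∈ lam.cells → (i2, j) ∈ lam.cells →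
      T i1 j < T i2 j) ∧
  (∀ i j : ℕ, (i, j) ∉ lam.cells → T i j = 0)

/-- The coefficient of the monomial `d` in the Schur polynomial `s_lam(x_1,…,x_m)`:
the number of SSYT of shape `lam` with content `d`. -/
def schurCoeff (m : ℕ) (lam : YoungDiagram) (d : Fin m →₀ ℕ) : ℕ :=
  Set.ncard {T : ℕ → ℕ → ℕ | IsSSYT m lam T ∧
    ∀ k : Fin m, d k = (lam.cells.filter fun c => T c.1 c.2 = k.val).card}

/-- The coefficientwise sum `Σ_{lam ∈ S} c(lam) · s_lam(x)` of Schur polynomials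
over a set `S` of partitions with coefficients `c`; it is well defined
coefficientwise since only finitely many partitions contribute to a given
coefficient. -/
def schurSum (m : ℕ) (S : Set YoungDiagram) (c : YoungDiagram → ℚ) :
    MvPowerSeries (Fin m) ℚ :=
  fun d => ∑' lam : S, c lam * (schurCoeff m (lam : YoungDiagram) d : ℚ)

/-- The Frobenius rank of a partition: the number of diagonal cells. -/
def frobRank (lam : YoungDiagram) : ℕ :=
  (lam.cells.filter fun c => c.1 = c.2).card

/-- The set `P_p` of partitions whose Frobenius arm and leg lengths satisfy
`a_k = b_k + p` for `k = 1,…,r(σ)`; equivalently `σ_k = σ'_k + p` for all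
`k ≤ r(σ)` (0-based: `rowLen σ k = colLen σ k + p` for all `k < r(σ)`). -/
def frobSet (p : ℕ) : Set YoungDiagram :=
  {lam | ∀ k < frobRank lam, lam.rowLen k = lam.colLen k + p}

open Matrix Polynomial in
theorem kg_q {K : Type*} [Field K] (n : ℕ) (x : Fin (n+1) → K) :
    ∃ q : ℕ → K, q n = (-1)^(n+1) * ∏ i, x i ∧
      ∀ t : K, ∏ j, (1 - t * x j)
        = (1 + t) * ∑ r ∈ Finset.range (n+1), q r * t^r + ∏ j, (1 + x j) := by
  let P : K[X] := ∏ j, (1 - X * C (x j))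
  let q := P /ₘ (X - C (-1))
  have hP : (X - C (-1)) * q + C (P.eval (-1)) = P := by
    have := modByMonic_add_div P (X - C (-1 : K))
    rw [modByMonic_X_sub_C_eq_C_eval] at this
    rw [add_comm]; exact this
  have hev : ∀ t, P.eval t = ∏ j, (1 - t * x j) := by
    intro t; simp only [P, eval_prod]; simp [mul_comm t]
  have hfac : ∀ j, (1 - X * C (x j) : K[X]).natDegree ≤ 1 := by
    intro j
    compute_degree
  have hdeg : P.natDegree ≤ n + 1 := by
    refine (natDegree_prod_le _ _).trans ?_
    refine (Finset.sum_le_sum (fun j _ => hfac j)).trans ?_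
    simp
  have hqdeg : q.natDegree ≤ n := by
    rw [natDegree_divByMonic _ (monic_X_sub_C _), natDegree_X_sub_C]; omega
  have hcoeff : P.coeff (n+1) = (-1)^(n+1) * ∏ i, x i := by
    have := coeff_prod_of_natDegree_le (s := Finset.univ) (f := fun j : Fin (n+1) => (1 - X * C (x j) : K[X])) 1 (fun j _ => hfac j)
    simp only [Finset.card_univ, Fintype.card_fin, mul_one] at this
    show (∏ j, (1 - X * C (x j) : K[X])).coeff (n+1) = _
    rw [this]
    have : ∀ i, (1 - X * C (x i) : K[X]).coeff 1 = - x i := by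
      intro i; simp [coeff_one]
    rw [Finset.prod_congr rfl (fun i _ => this i), Finset.prod_neg]; simp
  refine ⟨q.coeff, ?_, ?_⟩
  · rw [← hcoeff, ← hP]
    have h0 : q.coeff (n+1) = 0 := coeff_eq_zero_of_natDegree_lt (by omega)
    rw [sub_mul, coeff_add, coeff_sub, coeff_X_mul, coeff_C_mul, h0]; simp [coeff_C]
  · intro t
    rw [← hev t]
    conv_lhs => rw [← hP]
    rw [eval_add, eval_mul, eval_C, hev (-1), eval_eq_sum_range' (p := q) (n := n+1) (by omega)]
    simp
    left; ring

open Matrix in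
theorem kg_key {K : Type*} [Field K] (n : ℕ) (x Z : Fin (n+1) → K) (hx : ∀ i, x i ≠ 0)
    (h1 : ∀ i, 1 + x i ≠ 0) :
    (Matrix.of fun i j : Fin (n+1) => x i ^ (j:ℕ) - Z i * x i ^ (n+1-j)).det
    - (Matrix.of fun i j : Fin (n+1) => x i ^ (j:ℕ) - Z i * x i ^ (n-j)).det
    = ((Matrix.of fun i j : Fin (n+1) => x i ^ (j:ℕ) - Z i * x i ^ (n-1-j)).updateCol (Fin.last n)
        (fun i => Z i * (1 - x i) * ∏ j ∈ Finset.univ.erase i, (1 - x i * x j))).det := by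
  have hprod : ∏ j, (1 + x j) ≠ 0 := Finset.prod_ne_zero_iff.2 fun i _ => h1 i
  let A : Matrix (Fin (n+1)) (Fin (n+1)) K := .of fun i j => (1 + x i) * (x i ^ (j:ℕ) - Z i * x i ^ (n-1-j))
  let L : (Fin (n+1) → K) →ₗ[K] K := (LinearMap.proj (Fin.last n)).comp A.cramer
  have hL : ∀ z, L z = (A.updateCol (Fin.last n) z).det := fun z => rfl
  have hL0 : ∀ j : Fin n, L (fun i => A i j.castSucc) = 0 := by
    intro j
    show A.cramer _ (Fin.last n) = 0
    rw [cramer_row_self A _ j.castSucc (fun _ => rfl), Pi.single_eq_of_ne]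
    exact (Fin.castSucc_lt_last j).ne'
  -- scaling
  have hLs : ∀ z : Fin (n+1) → K, L (fun i => (1 + x i) * z i) = (∏ j, (1 + x j)) * 
      ((Matrix.of fun i j : Fin (n+1) => x i ^ (j:ℕ) - Z i * x i ^ (n-1-j)).updateCol (Fin.last n) z).det := by
    intro z
    rw [hL, ← det_mul_column]
    congr 1
    ext i j
    by_cases h : j = Fin.last n
    · subst h; simp
    · simp [h, A]
  obtain ⟨q, hqn, hq⟩ := kg_q n x
  -- L of low monomials
  have hlow : ∀ r ∈ Finset.range n, L (fun i => (1 + x i) * (Z i * x i ^ r)) = L (fun i => (1 + x i) * x i ^ (n-1-r)) := by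
    intro r hr
    rw [Finset.mem_range] at hr
    rw [← sub_eq_zero, ← map_sub, ← neg_eq_zero, ← map_neg]
    convert hL0 ⟨n-1-r, by omega⟩ using 2
    ext i
    simp [A]
    rw [show n - 1 - (n-1-r) = r by omega]; ring
  have hW : (fun i => (1 + x i) * (Z i * (1 - x i) * ∏ j ∈ Finset.univ.erase i, (1 - x i * x j)))
      = (∑ r ∈ Finset.range n, q r • (fun i => (1 + x i) * (Z i * x i ^ r))) + q n • (fun i => (1 + x i) * (Z i * x i ^ n))
        + (∏ j, (1 + x j)) • Z := by
    ext i
    have h2 : (1 + x i) * (Z i * (1 - x i) * ∏ j ∈ Finset.univ.erase i, (1 - x i * x j)) = Z i * ∏ j, (1 - x i * x j) := by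
      rw [← Finset.mul_prod_erase Finset.univ _ (Finset.mem_univ i)]; ring
    rw [h2, hq (x i), Finset.sum_range_succ]
    simp only [Pi.add_apply, Finset.sum_apply, Pi.smul_apply, smul_eq_mul]
    have : ∀ r, q r * ((1 + x i) * (Z i * x i ^ r)) = ((1 + x i) * Z i) * (q r * x i ^ r) := by intros; ring
    simp only [this, ← Finset.mul_sum]
    ring
  have hV : (∑ r ∈ Finset.range n, q r • (fun i => (1 + x i) * (x i ^ (n-1-r))))
     = - q n • (fun i => (1 + x i) * (x i)⁻¹) - (∏ j, (1 + x j)) • (fun i => x i ^ n) := by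
    ext i
    have h3 : ∏ j, (1 - (x i)⁻¹ * x j) = 0 := by
      apply Finset.prod_eq_zero (Finset.mem_univ i); simp [hx i]
    rw [hq (x i)⁻¹, Finset.sum_range_succ] at h3
    have h4 := congrArg (· * x i ^ n) h3
    simp only [zero_mul] at h4
    simp only [Pi.sub_apply, Finset.sum_apply, Pi.smul_apply, smul_eq_mul]
    have : ∀ r ∈ Finset.range n, q r * ((1 + x i) * (x i ^ (n-1-r))) = (1 + x i) * x i ^ (n-1) * (q r * (x i)⁻¹^r) := by
      intro r hr
      rw [Finset.mem_range] at hr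
      have : x i ^ (n-1) = x i ^ (n-1-r) * x i ^ r := by rw [← pow_add]; congr 1; omega
      rw [this, inv_pow]
      field_simp [hx i]
    rw [Finset.sum_congr rfl this, ← Finset.mul_sum]
    set Sg := ∑ r ∈ Finset.range n, q r * (x i)⁻¹^r with hS
    rcases n with _ | n
    · simp at hS; rw [hS] at h4 ⊢; simp at h4 ⊢
      have := hx i
      field_simp at h4 ⊢
      linear_combination h4
    · have := hx i
      simp only [Nat.add_sub_cancel]
      rw [inv_pow] at h4
      field_simp at h4 ⊢
      linear_combination h4
  apply mul_left_cancel₀ hprod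
  rw [← hLs, hW, map_add, map_add, map_sum]
  have e1 : ∑ r ∈ Finset.range n, L (q r • (fun i => (1 + x i) * (Z i * x i ^ r))) = 
     L (- q n • (fun i => (1 + x i) * (x i)⁻¹) - (∏ j, (1 + x j)) • (fun i => x i ^ n)) := by
    rw [← hV, map_sum]
    refine Finset.sum_congr rfl fun r hr => ?_
    rw [map_smul, map_smul, hlow r hr]
  have e2 : L (- q n • (fun i => (1 + x i) * (x i)⁻¹) - (∏ j, (1 + x j)) • (fun i => x i ^ n))
      + L (q n • (fun i => (1 + x i) * (Z i * x i ^ n))) + L ((∏ j, (1 + x j)) • Z)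
      = - q n * L (fun i => (1 + x i) * ((x i)⁻¹ - Z i * x i ^ n)) - (∏ j, (1 + x j)) * L (fun i => x i ^ n - Z i) := by
    rw [← smul_eq_mul, ← smul_eq_mul, ← map_smul, ← map_smul, ← map_add, ← map_add, ← map_sub]
    congr 1
    ext i
    simp; ring
  rw [e1, e2, hLs, hqn]
  have d1 : (∏ i, x i) * ((Matrix.of fun i j : Fin (n+1) => x i ^ (j:ℕ) - Z i * x i ^ (n-1-j)).updateCol (Fin.last n) (fun i => (x i)⁻¹ - Z i * x i ^ n)).det
     = (-1)^n * (Matrix.of fun i j : Fin (n+1) => x i ^ (j:ℕ) - Z i * x i ^ (n+1-j)).det := by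
    rw [← det_mul_column]
    have := det_permute' (finRotate (n+1)) (Matrix.of fun i j : Fin (n+1) => x i ^ (j:ℕ) - Z i * x i ^ (n+1-j))
    rw [sign_finRotate] at this
    simp at this
    rw [← this]
    congr 1
    ext i j
    induction j using Fin.lastCases with
    | last => simp [mul_sub, hx i]; ring
    | cast j =>
      have hj : (Fin.castSucc j) ≠ Fin.last n := (Fin.castSucc_lt_last j).ne
      have := j.isLt
      simp [hj, mul_sub]
      rw [show n - j.val = (n - 1 - j) + 1 by omega]
      ring
  have d2 : L (fun i => x i ^ n - Z i) = (Matrix.of fun i j : Fin (n+1) => x i ^ (j:ℕ) - Z i * x i ^ (n-j)).det := by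
    rw [hL, ← det_submatrix_equiv_self Fin.revPerm, ← det_submatrix_equiv_self Fin.revPerm (Matrix.of _)]
    symm
    apply det_eq_of_forall_col_eq_smul_add_pred (fun _ => -1)
    · intro i; simp
    · intro i j
      have h : Fin.rev j.succ ≠ Fin.last n := by
        intro h; have := congrArg Fin.val h; simp [Fin.val_rev] at this; have := j.isLt; omega
      have := j.isLt
      simp [A, h, Fin.val_rev]
      obtain ⟨k, hk⟩ : ∃ k, n = k + 1 + j := ⟨n - 1 - j, by omega⟩
      have e1 : n - 1 - (n - (j.val + 1)) = j := by omega
      have e2 : n - (n - (j.val + 1)) = j + 1 := by omega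
      have e3 : n - (n - j.val) = j := by omega
      have e4 : n - (j.val + 1) = k := by omega
      have e5 : n - j.val = k + 1 := by omega
      rw [e1, e2, e3, e4, e5]
      ring
  rw [d2]
  have s : ((-1 : K)^n) * (-1)^n = 1 := by rw [← mul_pow]; simp
  rw [pow_succ]
  linear_combination -(-1)^n * (∏ j, (1 + x j)) * d1 - (∏ j, (1 + x j)) * (Matrix.of fun i j : Fin (n+1) => x i ^ (j:ℕ) - Z i * x i ^ (n+1-j)).det * s


def kg_alt {R : Type*} [CommRing R] {m : ℕ} (x : Fin m → R) (k : Fin m → ℕ) : R :=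
  (Matrix.of fun i j : Fin m => x i ^ k j).det

open Classical in
def kg_seq (m N : ℕ) : Finset (Fin m → ℕ) :=
  (Fintype.piFinset fun _ : Fin m => Finset.range N).filter StrictMono

def kg_G {R : Type*} [CommRing R] {m : ℕ} (N : ℕ) (x : Fin m → R) : R :=
  ∑ k ∈ kg_seq m N, kg_alt x k

def kg_D {R : Type*} [CommRing R] {m : ℕ} (N : ℕ) (x : Fin m → R) : R :=
  (Matrix.of fun i j : Fin m => x i ^ (j:ℕ) - x i ^ (N+m-1-j)).det

def kg_B {R : Type*} [CommRing R] {m : ℕ} (x : Fin m → R) : R :=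
  (∏ i, (1 - x i)) * ∏ t ∈ Finset.powersetCard 2 Finset.univ, (1 - ∏ i ∈ t, x i)

theorem kg_mem_seq {m N : ℕ} {k : Fin m → ℕ} :
    k ∈ kg_seq m N ↔ (∀ i, k i < N) ∧ StrictMono k := by
  simp [kg_seq]

theorem kg_B_succ {R : Type*} [CommRing R] {n : ℕ} (x : Fin (n+1) → R) (i : Fin (n+1)) :
    kg_B x = (1 - x i) * (∏ j ∈ Finset.univ.erase i, (1 - x i * x j)) * kg_B (fun j => x (i.succAbove j)) := by
  have hu : (Finset.univ : Finset (Fin (n+1))) = insert i (Finset.univ.map i.succAboveEmb) := by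
    ext j
    simp
    by_cases h : j = i
    · simp [h]
    · simp [h]
  have hi : i ∉ Finset.univ.map i.succAboveEmb := by simp
  have he : Finset.univ.erase i = Finset.univ.map i.succAboveEmb := by
    conv_lhs => rw [hu]
    rw [Finset.erase_insert hi]
  unfold kg_B
  rw [he]
  conv_lhs => rw [hu]
  rw [Finset.prod_insert hi, Finset.powersetCard_succ_insert hi, Finset.prod_union, Finset.prod_image,
    Finset.powersetCard_one, Finset.powersetCard_map, Finset.prod_map, Finset.prod_map, Finset.prod_map,
    Finset.prod_map]
  · have : ∀ t : Finset (Fin n), ∏ j ∈ t.map i.succAboveEmb, x j = ∏ j ∈ t, x (i.succAbove j) := by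
      intro t; rw [Finset.prod_map]; rfl
    simp [this, Fin.succAbove_ne, Finset.prod_insert, (Fin.succAbove_ne _ _).symm, Finset.mapEmbedding]
    ring
  · intro a ha b hb hab
    rw [Finset.mem_coe, Finset.mem_powersetCard] at ha hb
    have ha' : i ∉ a := fun h => hi (ha.1 h)
    have hb' : i ∉ b := fun h => hi (hb.1 h)
    rw [← Finset.erase_insert ha', ← Finset.erase_insert hb', hab]
  · rw [Finset.disjoint_left]
    intro a ha hb
    rw [Finset.mem_powersetCard] at ha
    rw [Finset.mem_image] at hb
    obtain ⟨b, _, rfl⟩ := hb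
    exact hi (ha.1 (Finset.mem_insert_self _ _))

theorem kg_alt_snoc {R : Type*} [CommRing R] {n : ℕ} (x : Fin (n+1) → R) (k : Fin n → ℕ) (N : ℕ) :
    kg_alt x (Fin.snoc k N : Fin (n+1) → ℕ) = ∑ i : Fin (n+1), (-1)^(i+n : ℕ) * x i ^ N * kg_alt (fun j => x (i.succAbove j)) k := by
  unfold kg_alt
  rw [Matrix.det_succ_column _ (Fin.last n)]
  refine Finset.sum_congr rfl fun i _ => ?_
  simp only [Matrix.of_apply, Fin.snoc_last, Fin.val_last]
  congr 2
  ext a b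
  simp

theorem kg_seq_succ (n N : ℕ) : kg_seq (n+1) (N+1) = kg_seq (n+1) N ∪ (kg_seq n N).image (fun k => (Fin.snoc k N : Fin (n+1) → ℕ)) := by
  classical
  ext k
  simp only [Finset.mem_union, Finset.mem_image, kg_mem_seq]
  constructor
  · rintro ⟨h1, h2⟩
    by_cases h : k (Fin.last n) = N
    · right
      refine ⟨Fin.init k, ⟨fun i => ?_, fun i j hij => h2 (Fin.castSucc_lt_castSucc_iff.2 hij)⟩, ?_⟩
      · rw [← h]; exact h2 (Fin.castSucc_lt_last i)
      · rw [← h]; exact Fin.snoc_init_self k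
    · left
      refine ⟨fun i => ?_, h2⟩
      have := h2.monotone (Fin.le_last i)
      have := h1 (Fin.last n)
      omega
  · rintro (⟨h1, h2⟩ | ⟨k', ⟨h1, h2⟩, rfl⟩)
    · exact ⟨fun i => (h1 i).trans (by omega), h2⟩
    · refine ⟨fun i => ?_, ?_⟩
      · induction i using Fin.lastCases with
        | last => simp
        | cast i => have := h1 i; simp; omega
      · intro i j hij
        induction j using Fin.lastCases with
        | last =>
          induction i using Fin.lastCases with
          | last => exact absurd hij (lt_irrefl _)
          | cast i => simpa using h1 i
        | cast j =>
          induction i using Fin.lastCases with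
          | last => exact absurd hij (not_lt.2 (Fin.le_last _))
          | cast i => simpa using h2 (Fin.castSucc_lt_castSucc_iff.1 hij)

theorem kg_G_succ {R : Type*} [CommRing R] {n : ℕ} (N : ℕ) (x : Fin (n+1) → R) :
    kg_G (N+1) x = kg_G N x + ∑ i : Fin (n+1), (-1)^(i+n : ℕ) * x i ^ N * kg_G N (fun j => x (i.succAbove j)) := by
  classical
  unfold kg_G
  rw [kg_seq_succ, Finset.sum_union, Finset.sum_image]
  · simp only [kg_alt_snoc, Finset.mul_sum]
    rw [Finset.sum_comm]
  · intro a _ b _ hab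
    simpa using congrArg Fin.init hab
  · rw [Finset.disjoint_left]
    intro a ha hb
    rw [Finset.mem_image] at hb
    obtain ⟨b, _, rfl⟩ := hb
    have := (kg_mem_seq.1 ha).1 (Fin.last n)
    simp at this

theorem kg_D_zero {K : Type*} [Field K] {n : ℕ} (x : Fin (n+1) → K) (h2 : (2:K) ≠ 0) : kg_D 0 x = 0 := by
  unfold kg_D
  apply Matrix.exists_mulVec_eq_zero_iff.1
  refine ⟨Pi.single 0 1 + Pi.single (Fin.last n) 1, ?_, ?_⟩
  · intro h
    have := congrFun h 0
    rcases n with _ | n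
    · simp at this
      exact h2 (by rw [← this]; norm_num)
    · rw [Pi.add_apply, Pi.single_eq_same, Pi.single_eq_of_ne (Fin.last_pos).ne] at this
      simp at this
  · ext i
    rw [Matrix.mulVec_add]
    simp

theorem kg_D_eq {K : Type*} [Field K] (h2 : (2:K) ≠ 0) (m : ℕ) : ∀ (x : Fin m → K) (N : ℕ) (_ : ∀ i, x i ≠ 0)
    (_ : ∀ i, 1 + x i ≠ 0), kg_D N x = kg_B x * kg_G N x := by
  induction m with
  | zero =>
    intro x N _ _
    have : kg_seq 0 N = {default} := by
      ext k; simp [kg_mem_seq, Subsingleton.elim k default, Subsingleton.strictMono]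
    simp [kg_D, kg_B, kg_G, kg_alt, this]
    rw [Finset.powersetCard_eq_empty.2 (by simp)]; simp
  | succ n ih =>
    intro x N hx h1
    induction N with
    | zero =>
      rw [kg_D_zero x h2]
      have : kg_seq (n+1) 0 = ∅ := by
        ext k; simp [kg_mem_seq]
      simp [kg_G, this]
    | succ N ihN =>
      have key := kg_key n x (fun i => x i ^ N) hx h1
      have e1 : (Matrix.of fun i j : Fin (n+1) => x i ^ (j:ℕ) - x i ^ N * x i ^ (n+1-j)).det = kg_D (N+1) x := by
        unfold kg_D
        congr 1; ext i j
        have := j.isLt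
        simp only [Matrix.of_apply]
        rw [← pow_add]; congr 2; omega
      have e2 : (Matrix.of fun i j : Fin (n+1) => x i ^ (j:ℕ) - x i ^ N * x i ^ (n-j)).det = kg_D N x := by
        unfold kg_D
        congr 1; ext i j
        have := j.isLt
        simp only [Matrix.of_apply]
        rw [← pow_add]; congr 2; omega
      rw [e1, e2, ihN] at key
      rw [kg_G_succ, mul_add, ← sub_eq_iff_eq_add', key, Matrix.det_succ_column _ (Fin.last n), Finset.mul_sum]
      refine Finset.sum_congr rfl fun i _ => ?_
      have e3 : (((Matrix.of fun i j : Fin (n+1) => x i ^ (j:ℕ) - x i ^ N * x i ^ (n-1-j)).updateCol (Fin.last n)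
        (fun i => x i ^ N * (1 - x i) * ∏ j ∈ Finset.univ.erase i, (1 - x i * x j))).submatrix i.succAbove (Fin.last n).succAbove).det
         = kg_D N (fun j => x (i.succAbove j)) := by
        unfold kg_D
        congr 1; ext a b
        have := b.isLt
        have hb : (Fin.castSucc b) ≠ Fin.last n := (Fin.castSucc_lt_last b).ne
        simp [hb]
        rw [← pow_add]; congr 1; omega
      rw [e3, ih _ N (fun j => hx _) (fun j => h1 _), kg_B_succ x i]
      simp
      ring


theorem kg_det_col_sum {R : Type*} [CommRing R] {n : ℕ} (s : Fin n → Finset ℕ) (c : Fin n → Fin n → ℕ → R) :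
    (Matrix.of fun i j : Fin n => ∑ t ∈ s j, c i j t).det
      = ∑ k ∈ Fintype.piFinset s, (Matrix.of fun i j : Fin n => c i j (k j)).det := by
  rw [← Matrix.det_transpose]
  have := (Matrix.detRowAlternating (n := Fin n) (R := R)).toMultilinearMap.map_sum_finset
    (fun j t => fun i => c i j t) s
  simp only [AlternatingMap.coe_multilinearMap] at this
  refine Eq.trans ?_ (this.trans ?_)
  · show Matrix.det _ = Matrix.det _
    congr 1; ext i j; simp
  · refine Finset.sum_congr rfl fun k _ => ?_
    rw [← Matrix.det_transpose]; rfl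

theorem kg_alt_branch {R : Type*} [CommRing R] {n : ℕ} (x : Fin (n+1) → R) (l : Fin (n+1) → ℕ)
    (hl : ∀ j : Fin n, l j.castSucc ≤ l j.succ) :
    kg_alt x l = ((-1)^n * ∏ i : Fin n, (x i.castSucc - x (Fin.last n))) *
      (x (Fin.last n) ^ l 0 * ∑ k ∈ Fintype.piFinset (fun j : Fin n => Finset.Ico (l j.castSucc) (l j.succ)),
        (∏ j, x (Fin.last n) ^ (l j.succ - 1 - k j)) * kg_alt (fun i => x i.castSucc) k) := by
  set z := x (Fin.last n) with hz
  let A : Matrix (Fin (n+1)) (Fin (n+1)) R := .of fun i j =>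
    Fin.cases (x i ^ l 0) (fun j => x i ^ l j.succ - z ^ (l j.succ - l j.castSucc) * x i ^ l j.castSucc) j
  have h1 : kg_alt x l = A.det := by
    unfold kg_alt
    apply Matrix.det_eq_of_forall_col_eq_smul_add_pred (fun j => z ^ (l j.succ - l j.castSucc))
    · intro i; simp [A]
    · intro i j; simp [A]
  have h2 : A.det = (-1)^n * z ^ l 0 * (A.submatrix Fin.castSucc Fin.succ).det := by
    rw [Matrix.det_succ_row _ (Fin.last n), Finset.sum_eq_single 0]
    · simp [A, ← hz]
    · intro j _ hj
      obtain ⟨j, rfl⟩ := Fin.exists_succ_eq.2 hj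
      have : A (Fin.last n) j.succ = 0 := by
        simp [A, ← hz]
        rw [← pow_add, Nat.sub_add_cancel (hl j), sub_self]
      rw [this]; ring
    · simp
  have h3 : (A.submatrix Fin.castSucc Fin.succ).det = (∏ i : Fin n, (x i.castSucc - z)) *
      (Matrix.of fun i j : Fin n => ∑ t ∈ Finset.Ico (l j.castSucc) (l j.succ), z ^ (l j.succ - 1 - t) * x i.castSucc ^ t).det := by
    rw [← Matrix.det_mul_column]
    congr 1
    ext i j
    simp [A]
    have := (Commute.all (x i.castSucc) z).mul_geom_sum₂_Ico (hl j)
    simp only [mul_comm (z ^ _)]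
    rw [this]
  rw [h1, h2, h3, kg_det_col_sum]
  have h4 : ∀ k : Fin n → ℕ, (Matrix.of fun i j : Fin n => z ^ (l j.succ - 1 - k j) * x i.castSucc ^ k j).det
     = (∏ j, z ^ (l j.succ - 1 - k j)) * kg_alt (fun i => x i.castSucc) k := by
    intro k
    unfold kg_alt
    rw [← Matrix.det_mul_row]; rfl
  simp only [h4]
  ring

theorem kg_alt_id {R : Type*} [CommRing R] {n : ℕ} (x : Fin (n+1) → R) :
    kg_alt x (fun i => (i : ℕ)) = ((-1)^n * ∏ i : Fin n, (x i.castSucc - x (Fin.last n))) *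
      kg_alt (fun i : Fin n => x i.castSucc) (fun i => (i : ℕ)) := by
  rw [kg_alt_branch x _ (by intro j; simp)]
  have : Fintype.piFinset (fun j : Fin n => Finset.Ico ((j.castSucc : Fin (n+1)) : ℕ) (j.succ : Fin (n+1))) = {fun j : Fin n => (j : ℕ)} := by
    ext k
    simp [funext_iff]
  rw [this]
  simp


/-! ### Young diagrams -/

def kg_exps (m : ℕ) (lam : YoungDiagram) : Fin m → ℕ := fun i => lam.rowLen (m - 1 - i) + i

theorem kg_rowLen_eq {lam : YoungDiagram} {i a : ℕ} (h : ∀ j, (i, j) ∈ lam ↔ j < a) : lam.rowLen i = a :=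
  eq_of_forall_lt_iff fun j => by rw [← h, YoungDiagram.mem_iff_lt_rowLen]

theorem kg_colLen_eq {lam : YoungDiagram} {j a : ℕ} (h : ∀ i, (i, j) ∈ lam ↔ i < a) : lam.colLen j = a :=
  eq_of_forall_lt_iff fun i => by rw [← h, YoungDiagram.mem_iff_lt_colLen]

theorem kg_ext {lam mu : YoungDiagram} (h : ∀ i j, (i, j) ∈ lam ↔ (i, j) ∈ mu) : lam = mu := by
  ext ⟨i, j⟩; exact h i j

theorem kg_ext_row {lam mu : YoungDiagram} (h : ∀ i, lam.rowLen i = mu.rowLen i) : lam = mu :=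
  kg_ext fun i j => by rw [YoungDiagram.mem_iff_lt_rowLen, YoungDiagram.mem_iff_lt_rowLen, h]

theorem kg_row_zero {lam : YoungDiagram} {m : ℕ} : lam.colLen 0 ≤ m ↔ lam.rowLen m = 0 := by
  have := YoungDiagram.mem_iff_lt_colLen (μ := lam) (i := m) (j := 0)
  have := YoungDiagram.mem_iff_lt_rowLen (μ := lam) (i := m) (j := 0)
  constructor
  · intro h
    by_contra h'
    have : 0 < lam.rowLen m := by omega
    simp_all; omega
  · intro h
    by_contra h'
    have : m < lam.colLen 0 := by omega
    simp_all

theorem kg_row_zero' {lam : YoungDiagram} {m i : ℕ} (h : lam.colLen 0 ≤ m) (hi : m ≤ i) : lam.rowLen i = 0 := by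
  have := lam.rowLen_anti m i hi
  have := kg_row_zero.1 h
  omega

def kg_mk (f : ℕ → ℕ) (hf : Antitone f) (m : ℕ) : YoungDiagram where
  cells := (Finset.range m ×ˢ Finset.range (f 0)).filter (fun c => c.2 < f c.1)
  isLowerSet := by
    rintro ⟨i, j⟩ ⟨i', j'⟩ ⟨h1, h2⟩ h
    simp at h h1 h2 ⊢
    have := hf h1
    have := hf (Nat.zero_le i')
    omega

theorem kg_mem_mk {f : ℕ → ℕ} {hf : Antitone f} {m : ℕ} (h : f m = 0) {i j : ℕ} :
    (i, j) ∈ kg_mk f hf m ↔ j < f i := by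
  rw [← YoungDiagram.mem_cells]
  simp [kg_mk]
  intro hj
  have h0 := hf (Nat.zero_le i)
  refine ⟨?_, by omega⟩
  by_contra hi
  have := hf (not_lt.1 hi)
  omega

theorem kg_rowLen_mk {f : ℕ → ℕ} {hf : Antitone f} {m : ℕ} (h : f m = 0) (i : ℕ) :
    (kg_mk f hf m).rowLen i = f i := kg_rowLen_eq fun _ => kg_mem_mk h

theorem kg_card {lam : YoungDiagram} {m : ℕ} (h : lam.colLen 0 ≤ m) :
    lam.cells.card = ∑ i ∈ Finset.range m, lam.rowLen i := by
  have : ∀ c ∈ lam.cells, c.1 ∈ Finset.range m := by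
    rintro ⟨i, j⟩ hc
    rw [YoungDiagram.mem_cells, YoungDiagram.mem_iff_lt_rowLen] at hc
    rw [Finset.mem_range]
    by_contra hi
    rw [kg_row_zero' h (not_lt.1 hi)] at hc
    omega
  rw [Finset.card_eq_sum_card_fiberwise this]
  refine Finset.sum_congr rfl fun i _ => ?_
  rw [YoungDiagram.rowLen_eq_card]; rfl

theorem kg_strict_aux {m : ℕ} {k : Fin m → ℕ} (hk : StrictMono k) (d : ℕ) :
    ∀ i j : Fin m, j.val = i.val + d → k i + d ≤ k j := by
  induction d with
  | zero => intro i j h; rw [show j = i from Fin.ext h]; simp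
  | succ d ih =>
    intro i j h
    have := ih i ⟨i + d, by omega⟩ rfl
    have h2 : k ⟨i + d, by omega⟩ < k j := hk (by rw [Fin.lt_def]; simp; omega)
    omega

theorem kg_strict_le {m : ℕ} {k : Fin m → ℕ} (hk : StrictMono k) (i : Fin m) : i.val ≤ k i := by
  have := kg_strict_aux hk i.val ⟨0, lt_of_le_of_lt (Nat.zero_le _) i.isLt⟩ i (by simp)
  omega

theorem kg_exps_strict (m : ℕ) (lam : YoungDiagram) : StrictMono (kg_exps m lam) := by
  intro i j h
  have := lam.rowLen_anti (m-1-j) (m-1-i) (by rw [Fin.lt_def] at h; omega)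
  rw [Fin.lt_def] at h
  unfold kg_exps
  omega

theorem kg_exps_surj {m : ℕ} {k : Fin m → ℕ} (hk : StrictMono k) :
    ∃ lam : YoungDiagram, lam.colLen 0 ≤ m ∧ kg_exps m lam = k := by
  let f : ℕ → ℕ := fun i => if h : i < m then k ⟨m-1-i, by omega⟩ - (m-1-i) else 0
  have hf : Antitone f := by
    intro a b hab
    simp only [f]
    split_ifs with h1 h2
    · have := kg_strict_aux hk (b - a) ⟨m-1-b, by omega⟩ ⟨m-1-a, by omega⟩ (by simp; omega)
      omega
    · omega
    · omega
    · omega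
  have hm : f m = 0 := by simp [f]
  refine ⟨kg_mk f hf m, ?_, ?_⟩
  · rw [kg_row_zero, kg_rowLen_mk hm, hm]
  · ext i
    unfold kg_exps
    rw [kg_rowLen_mk hm]
    have hi := i.isLt
    have e : m - 1 - (m - 1 - i.val) = i := by omega
    have := kg_strict_le hk i
    simp only [f]
    rw [dif_pos (by omega)]
    simp only [e]
    show k i - i.val + i.val = k i
    omega

theorem kg_exps_inj {m : ℕ} {lam mu : YoungDiagram} (h1 : lam.colLen 0 ≤ m) (h2 : mu.colLen 0 ≤ m)
    (h : kg_exps m lam = kg_exps m mu) : lam = mu := by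
  apply kg_ext_row
  intro i
  by_cases hi : i < m
  · have := congrFun h ⟨m-1-i, by omega⟩
    simp only [kg_exps] at this
    rw [show m - 1 - (m-1-i) = i by omega] at this
    omega
  · rw [kg_row_zero' h1 (not_lt.1 hi), kg_row_zero' h2 (not_lt.1 hi)]

/-! ### Tableaux -/

theorem kg_tab_finite (m : ℕ) (lam : YoungDiagram) : {T | IsSSYT m lam T}.Finite := by
  have : Function.Injective (fun (T : {T | IsSSYT m lam T}) (c : lam.cells) =>
      (⟨T.1 c.1.1 c.1.2, T.2.1 _ _ c.2⟩ : Fin m)) := by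
    rintro ⟨T, hT⟩ ⟨T', hT'⟩ h
    apply Subtype.ext
    ext i j
    by_cases hc : (i, j) ∈ lam.cells
    · have := congrFun h ⟨(i, j), hc⟩
      simpa using this
    · show T i j = T' i j
      rw [hT.2.2.2 i j hc, hT'.2.2.2 i j hc]
  have := Finite.of_injective _ this
  exact Set.toFinite _


def kg_tabs (m : ℕ) (lam : YoungDiagram) : Finset (ℕ → ℕ → ℕ) := (kg_tab_finite m lam).toFinset

theorem kg_mem_tabs {m : ℕ} {lam : YoungDiagram} {T : ℕ → ℕ → ℕ} : T ∈ kg_tabs m lam ↔ IsSSYT m lam T := by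
  simp [kg_tabs]

def kg_S {R : Type*} [CommRing R] (x : ℕ → R) (m : ℕ) (lam : YoungDiagram) : R :=
  ∑ T ∈ kg_tabs m lam, ∏ c ∈ lam.cells, x (T c.1 c.2)

theorem kg_strip_finite (lam : YoungDiagram) :
    {mu : YoungDiagram | mu ≤ lam ∧ ∀ i, lam.rowLen (i+1) ≤ mu.rowLen i}.Finite := by
  apply Set.Finite.subset (Set.Finite.preimage (f := YoungDiagram.cells) (s := (lam.cells.powerset : Set (Finset (ℕ × ℕ)))) ?_ (Finset.finite_toSet _))
  · rintro mu ⟨h, _⟩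
    simp only [Set.mem_preimage, Finset.mem_coe, Finset.mem_powerset]
    exact YoungDiagram.cells_subset_iff.2 h
  · intro a _ b _ h
    exact YoungDiagram.ext h

def kg_strips (lam : YoungDiagram) : Finset YoungDiagram := (kg_strip_finite lam).toFinset

theorem kg_mem_strips {lam mu : YoungDiagram} :
    mu ∈ kg_strips lam ↔ mu ≤ lam ∧ ∀ i, lam.rowLen (i+1) ≤ mu.rowLen i := by
  simp [kg_strips]

theorem kg_col_le {m : ℕ} {lam : YoungDiagram} {T : ℕ → ℕ → ℕ} (h : IsSSYT m lam T) :
    ∀ i, (i, 0) ∈ lam → i ≤ T i 0 := by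
  intro i
  induction i with
  | zero => intro _; omega
  | succ i ih =>
    intro hi
    have h1 : (i, 0) ∈ lam := lam.up_left_mem (Nat.le_succ i) le_rfl hi
    have := ih h1
    have := h.2.2.1 i (i+1) 0 (by omega) h1 hi
    omega

theorem kg_tabs_empty {m : ℕ} {lam : YoungDiagram} (h : m < lam.colLen 0) : kg_tabs m lam = ∅ := by
  ext T
  simp only [kg_mem_tabs, Finset.notMem_empty, iff_false]
  intro hT
  have h1 : (m, 0) ∈ lam := YoungDiagram.mem_iff_lt_colLen.2 h
  have := kg_col_le hT m h1
  have := hT.1 m 0 h1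
  omega

open Classical in
def kg_shp (m : ℕ) (lam : YoungDiagram) (T : ℕ → ℕ → ℕ) : YoungDiagram where
  cells := lam.cells.filter (fun c => ∀ c' : ℕ × ℕ, c' ≤ c → T c'.1 c'.2 < m)
  isLowerSet := by
    intro c c' h hc
    simp only [Finset.coe_filter, Set.mem_ofPred_eq] at hc ⊢
    exact ⟨lam.isLowerSet h hc.1, fun d hd => hc.2 d (hd.trans h)⟩

theorem kg_mem_shp {m : ℕ} {lam : YoungDiagram} {T : ℕ → ℕ → ℕ} {n : ℕ} (hT : IsSSYT n lam T) {i j : ℕ} :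
    (i, j) ∈ kg_shp m lam T ↔ (i, j) ∈ lam ∧ T i j < m := by
  rw [← YoungDiagram.mem_cells]
  simp only [kg_shp, Finset.mem_filter, YoungDiagram.mem_cells]
  constructor
  · rintro ⟨h1, h2⟩
    exact ⟨h1, h2 (i, j) le_rfl⟩
  · rintro ⟨h1, h2⟩
    refine ⟨h1, ?_⟩
    rintro ⟨i', j'⟩ ⟨hi, hj⟩
    simp only at hi hj ⊢
    have e1 : (i', j') ∈ lam := lam.up_left_mem hi hj h1
    have e2 : (i', j) ∈ lam := lam.up_left_mem hi le_rfl h1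
    have a1 := hT.2.1 i' j' j hj e1 e2
    rcases hi.lt_or_eq with hi | rfl
    · have a2 := hT.2.2.1 i' i j hi e2 h1
      omega
    · omega

open Classical in
def kg_restr (mu : YoungDiagram) (T : ℕ → ℕ → ℕ) : ℕ → ℕ → ℕ :=
  fun i j => if (i, j) ∈ mu then T i j else 0

open Classical in
def kg_glue (m : ℕ) (lam mu : YoungDiagram) (T : ℕ → ℕ → ℕ) : ℕ → ℕ → ℕ :=
  fun i j => if (i, j) ∈ mu then T i j else if (i, j) ∈ lam then m else 0

theorem kg_shp_strip {m : ℕ} {lam : YoungDiagram} {T : ℕ → ℕ → ℕ} (hT : IsSSYT (m+1) lam T) :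
    kg_shp m lam T ≤ lam ∧ ∀ i, lam.rowLen (i+1) ≤ (kg_shp m lam T).rowLen i := by
  constructor
  · rintro ⟨i, j⟩ h
    exact ((kg_mem_shp hT).1 h).1
  · intro i
    apply le_of_forall_lt
    intro j hj
    rw [← YoungDiagram.mem_iff_lt_rowLen] at hj ⊢
    have h1 : (i, j) ∈ lam := lam.up_left_mem (Nat.le_succ i) le_rfl hj
    have := hT.2.2.1 i (i+1) j (by omega) h1 hj
    have := hT.1 (i+1) j hj
    exact (kg_mem_shp hT).2 ⟨h1, by omega⟩

theorem kg_restr_ssyt {m : ℕ} {lam : YoungDiagram} {T : ℕ → ℕ → ℕ} (hT : IsSSYT (m+1) lam T) :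
    IsSSYT m (kg_shp m lam T) (kg_restr (kg_shp m lam T) T) := by
  simp only [IsSSYT, YoungDiagram.mem_cells]
  refine ⟨?_, ?_, ?_, ?_⟩
  · intro i j h
    simp only [kg_restr, if_pos h]
    exact ((kg_mem_shp hT).1 h).2
  · intro i j1 j2 hj h1 h2
    simp only [kg_restr, if_pos h1, if_pos h2]
    exact hT.2.1 i j1 j2 hj ((kg_mem_shp hT).1 h1).1 ((kg_mem_shp hT).1 h2).1
  · intro i j1 j2 hj h1 h2
    simp only [kg_restr, if_pos h1, if_pos h2]
    exact hT.2.2.1 i j1 j2 hj ((kg_mem_shp hT).1 h1).1 ((kg_mem_shp hT).1 h2).1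
  · intro i j h
    simp only [kg_restr, if_neg h]

theorem kg_glue_ssyt {m : ℕ} {lam mu : YoungDiagram} {T : ℕ → ℕ → ℕ} (hT : IsSSYT m mu T) (h1 : mu ≤ lam)
    (h2 : ∀ i, lam.rowLen (i+1) ≤ mu.rowLen i) : IsSSYT (m+1) lam (kg_glue m lam mu T) := by
  simp only [IsSSYT, YoungDiagram.mem_cells] at hT ⊢
  obtain ⟨a, b, c, d⟩ := hT
  refine ⟨?_, ?_, ?_, ?_⟩
  · intro i j h
    by_cases hm : (i, j) ∈ mu
    · simp only [kg_glue, if_pos hm]; have := a i j hm; omega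
    · simp only [kg_glue, if_neg hm, if_pos h]; omega
  · intro i j1 j2 hj e1 e2
    by_cases hm : (i, j2) ∈ mu
    · have hm1 := mu.up_left_mem le_rfl hj hm
      simp only [kg_glue, if_pos hm, if_pos hm1]
      exact b i j1 j2 hj hm1 hm
    · by_cases hm1 : (i, j1) ∈ mu
      · simp only [kg_glue, if_pos hm1, if_neg hm, if_pos e2]; have := a i j1 hm1; omega
      · simp only [kg_glue, if_neg hm1, if_neg hm, if_pos e2, if_pos e1]; omega
  · intro i1 i2 j hi e1 e2
    have hm1 : (i1, j) ∈ mu := by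
      have := lam.rowLen_anti (i1+1) i2 hi
      have := h2 i1
      rw [YoungDiagram.mem_iff_lt_rowLen] at e2 ⊢
      omega
    by_cases hm : (i2, j) ∈ mu
    · simp only [kg_glue, if_pos hm, if_pos hm1]
      exact c i1 i2 j hi hm1 hm
    · simp only [kg_glue, if_pos hm1, if_neg hm, if_pos e2]; exact a i1 j hm1
  · intro i j h
    have : (i, j) ∉ mu := fun h' => h (h1 h')
    simp only [kg_glue, if_neg h, if_neg this]

theorem kg_shp_glue {m : ℕ} {lam mu : YoungDiagram} {T : ℕ → ℕ → ℕ} (hT : IsSSYT m mu T) (h1 : mu ≤ lam)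
    (h2 : ∀ i, lam.rowLen (i+1) ≤ mu.rowLen i) : kg_shp m lam (kg_glue m lam mu T) = mu := by
  apply kg_ext
  intro i j
  rw [kg_mem_shp (kg_glue_ssyt hT h1 h2)]
  constructor
  · rintro ⟨e1, e2⟩
    by_contra hm
    simp only [kg_glue, if_neg hm, if_pos e1] at e2
    omega
  · intro hm
    refine ⟨h1 hm, ?_⟩
    simp only [kg_glue, if_pos hm]
    exact hT.1 i j hm

theorem kg_restr_glue {m : ℕ} {lam mu : YoungDiagram} {T : ℕ → ℕ → ℕ} (hT : IsSSYT m mu T) :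
    kg_restr mu (kg_glue m lam mu T) = T := by
  funext i j
  by_cases hm : (i, j) ∈ mu
  · simp only [kg_restr, kg_glue, if_pos hm]
  · simp only [kg_restr, if_neg hm]
    exact (hT.2.2.2 i j hm).symm

theorem kg_glue_restr {m : ℕ} {lam : YoungDiagram} {T : ℕ → ℕ → ℕ} (hT : IsSSYT (m+1) lam T) :
    kg_glue m lam (kg_shp m lam T) (kg_restr (kg_shp m lam T) T) = T := by
  funext i j
  by_cases hm : (i, j) ∈ kg_shp m lam T
  · simp only [kg_restr, kg_glue, if_pos hm]
  · simp only [kg_glue, if_neg hm]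
    split_ifs with h
    · rw [kg_mem_shp hT] at hm
      have := hT.1 i j h
      have : ¬ (T i j < m) := fun h' => hm ⟨h, h'⟩
      omega
    · exact (hT.2.2.2 i j h).symm

theorem kg_S_branch {R : Type*} [CommRing R] (x : ℕ → R) (m : ℕ) (lam : YoungDiagram) :
    kg_S x (m+1) lam = ∑ mu ∈ kg_strips lam, kg_S x m mu * x m ^ (lam.cells.card - mu.cells.card) := by
  unfold kg_S
  simp only [Finset.sum_mul]
  rw [Finset.sum_sigma']
  refine Finset.sum_bij' (fun T _ => ⟨kg_shp m lam T, kg_restr (kg_shp m lam T) T⟩)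
    (fun P _ => kg_glue m lam P.1 P.2) ?_ ?_ ?_ ?_ ?_
  · intro T hT
    rw [kg_mem_tabs] at hT
    simp only [Finset.mem_sigma, kg_mem_tabs, kg_mem_strips]
    exact ⟨kg_shp_strip hT, kg_restr_ssyt hT⟩
  · rintro ⟨mu, T⟩ hT
    simp only [Finset.mem_sigma, kg_mem_tabs, kg_mem_strips] at hT ⊢
    exact kg_glue_ssyt hT.2 hT.1.1 hT.1.2
  · intro T hT
    rw [kg_mem_tabs] at hT
    exact kg_glue_restr hT
  · rintro ⟨mu, T⟩ hT
    simp only [Finset.mem_sigma, kg_mem_tabs, kg_mem_strips] at hT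
    simp only
    rw [kg_shp_glue hT.2 hT.1.1 hT.1.2, kg_restr_glue hT.2]
  · intro T hT
    rw [kg_mem_tabs] at hT
    simp only
    have hs : (kg_shp m lam T).cells ⊆ lam.cells := YoungDiagram.cells_subset_iff.2 (kg_shp_strip hT).1
    rw [← Finset.card_sdiff_of_subset hs, ← Finset.prod_sdiff hs, mul_comm]
    congr 1
    · refine Finset.prod_congr rfl ?_
      rintro ⟨i, j⟩ hc
      rw [YoungDiagram.mem_cells] at hc
      simp only [kg_restr, if_pos hc]
    · apply Finset.prod_eq_pow_card
      rintro ⟨i, j⟩ hc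
      simp only [Finset.mem_sdiff, YoungDiagram.mem_cells, kg_mem_shp hT] at hc
      have := hT.1 i j hc.1
      have : ¬ (T i j < m) := fun h' => hc.2 ⟨hc.1, h'⟩
      rw [show T i j = m by omega]


theorem kg_tabs_bot (m : ℕ) : kg_tabs m ⊥ = {fun _ _ => 0} := by
  ext T
  rw [kg_mem_tabs, Finset.mem_singleton]
  constructor
  · intro h
    funext i j
    exact h.2.2.2 i j (by simp)
  · rintro rfl
    simp [IsSSYT]

theorem kg_rowLen_mono {lam mu : YoungDiagram} (h : mu ≤ lam) (i : ℕ) : mu.rowLen i ≤ lam.rowLen i := by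
  apply le_of_forall_lt
  intro j hj
  rw [← YoungDiagram.mem_iff_lt_rowLen] at hj ⊢
  exact h hj

theorem kg_le_of_row {lam mu : YoungDiagram} (h : ∀ i, mu.rowLen i ≤ lam.rowLen i) : mu ≤ lam := by
  rintro ⟨i, j⟩ hm
  have hm' : (i, j) ∈ mu := hm
  show (i, j) ∈ lam
  rw [YoungDiagram.mem_iff_lt_rowLen] at hm' ⊢
  exact lt_of_lt_of_le hm' (h i)

theorem kg_exp_sum {m : ℕ} {lam mu : YoungDiagram} (h : lam.colLen 0 ≤ m + 1) (h' : mu.colLen 0 ≤ m)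
    (hle : mu ≤ lam) :
    kg_exps (m+1) lam 0 + ∑ j : Fin m, (kg_exps (m+1) lam j.succ - 1 - kg_exps m mu j)
      = lam.cells.card - mu.cells.card := by
  have e : ∑ j : Fin m, (kg_exps (m+1) lam j.succ - 1 - kg_exps m mu j)
      = ∑ i ∈ Finset.range m, (lam.rowLen i - mu.rowLen i) := by
    rw [← Finset.sum_range_reflect, ← Fin.sum_univ_eq_sum_range (fun j => lam.rowLen (m-1-j) - mu.rowLen (m-1-j))]
    refine Finset.sum_congr rfl fun j _ => ?_
    simp only [kg_exps, Fin.val_succ]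
    rw [show m + 1 - 1 - (j.val + 1) = m - 1 - j by omega]
    omega
  rw [e, kg_card h, kg_card h', Finset.sum_range_succ]
  have : ∑ i ∈ Finset.range m, lam.rowLen i = ∑ i ∈ Finset.range m, (lam.rowLen i - mu.rowLen i) + ∑ i ∈ Finset.range m, mu.rowLen i := by
    rw [← Finset.sum_add_distrib]
    refine Finset.sum_congr rfl fun i _ => ?_
    have := kg_rowLen_mono hle i
    omega
  have : kg_exps (m+1) lam 0 = lam.rowLen m := by simp [kg_exps]
  omega

theorem kg_bialt {R : Type*} [CommRing R] (x : ℕ → R) (m : ℕ) : ∀ lam : YoungDiagram, lam.colLen 0 ≤ m →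
    kg_S x m lam * kg_alt (fun i : Fin m => x i) (fun i => (i : ℕ))
      = kg_alt (fun i : Fin m => x i) (kg_exps m lam) := by
  induction m with
  | zero =>
    intro lam h
    have : lam = ⊥ := by
      apply kg_ext_row
      intro i
      rw [kg_row_zero' h (Nat.zero_le i), YoungDiagram.rowLen_eq_card]
      simp [YoungDiagram.row]
    subst this
    simp [kg_S, kg_tabs_bot, kg_alt]
  | succ m ih =>
    intro lam h
    rw [kg_alt_branch _ _ (fun j => ((kg_exps_strict (m+1) lam) (Fin.castSucc_lt_succ)).le), kg_alt_id,
      mul_left_comm]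
    congr 1
    simp only [Fin.val_last, Fin.val_castSucc]
    rw [kg_S_branch, Finset.sum_mul, Finset.mul_sum]
    rw [← Finset.sum_filter_of_ne (p := fun mu => mu.colLen 0 ≤ m)]
    swap
    · intro mu _ hne
      by_contra hc
      apply hne
      simp [kg_S, kg_tabs_empty (not_le.1 hc)]
    refine Finset.sum_bij (fun mu _ => kg_exps m mu) ?_ ?_ ?_ ?_
    · intro mu hmu
      simp only [Finset.mem_filter, kg_mem_strips] at hmu
      obtain ⟨⟨h1, h2⟩, h3⟩ := hmu
      simp only [Fintype.mem_piFinset, Finset.mem_Ico]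
      intro j
      have a1 := h2 (m - 1 - j)
      have a2 := kg_rowLen_mono h1 (m-1-j)
      simp only [kg_exps, Fin.val_succ, Fin.val_castSucc]
      rw [show m + 1 - 1 - (j.val + 1) = m - 1 - j by omega, show m + 1 - 1 - j.val = m - 1 - j + 1 by omega]
      omega
    · intro mu hmu mu' hmu' he
      simp only [Finset.mem_filter, kg_mem_strips] at hmu hmu'
      exact kg_exps_inj hmu.2 hmu'.2 he
    · intro k hk
      simp only [Fintype.mem_piFinset, Finset.mem_Ico] at hk
      have hs : StrictMono k := by
        intro i j hij
        have h1 := (hk i).2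
        have h2 := (hk j).1
        have h3 : kg_exps (m+1) lam i.succ ≤ kg_exps (m+1) lam j.castSucc := by
          apply (kg_exps_strict (m+1) lam).monotone
          rw [Fin.le_def]; rw [Fin.lt_def] at hij
          simp; omega
        omega
      obtain ⟨mu, hmu, rfl⟩ := kg_exps_surj hs
      refine ⟨mu, ?_, rfl⟩
      simp only [Finset.mem_filter, kg_mem_strips]
      have key : ∀ i, lam.rowLen (i+1) ≤ mu.rowLen i ∧ mu.rowLen i ≤ lam.rowLen i := by
        intro i
        by_cases hi : i < m
        · have := hk ⟨m-1-i, by omega⟩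
          simp only [kg_exps, Fin.val_succ, Fin.val_castSucc] at this
          rw [show m + 1 - 1 - (m - 1 - i + 1) = i by omega, show m + 1 - 1 - (m-1-i) = i + 1 by omega,
            show m - 1 - (m - 1 - i) = i by omega] at this
          omega
        · rw [kg_row_zero' h (show m + 1 ≤ i + 1 by omega), kg_row_zero' hmu (not_lt.1 hi)]
          omega
      exact ⟨⟨kg_le_of_row fun i => (key i).2, fun i => (key i).1⟩, hmu⟩
    · intro mu hmu
      simp only [Finset.mem_filter, kg_mem_strips] at hmu
      rw [Finset.prod_pow_eq_pow_sum, ← mul_assoc, ← pow_add, kg_exp_sum h hmu.2 hmu.1.1, ← ih mu hmu.2]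
      ring


/-! ### Link with power series -/

def kg_X (m : ℕ) (k : ℕ) : MvPowerSeries (Fin m) ℚ :=
  if h : k < m then MvPowerSeries.X ⟨k, h⟩ else 0

theorem kg_prod_X {m : ℕ} (f : ℕ × ℕ → ℕ) (s : Finset (ℕ × ℕ)) (hs : ∀ c ∈ s, f c < m) :
    ∏ c ∈ s, kg_X m (f c) = MvPowerSeries.monomial
      (Finsupp.equivFunOnFinite.symm fun k : Fin m => (s.filter fun c => f c = k.val).card) 1 := by
  classical
  induction s using Finset.induction_on with
  | empty =>
    simp only [Finset.prod_empty, Finset.filter_empty, Finset.card_empty]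
    rw [← MvPowerSeries.monomial_zero_one]
    congr 2
    ext k
    simp
  | insert a s ha ih =>
    rw [Finset.prod_insert ha, ih (fun c hc => hs c (Finset.mem_insert_of_mem hc))]
    have h := hs a (Finset.mem_insert_self _ _)
    rw [kg_X, dif_pos h, MvPowerSeries.X, MvPowerSeries.monomial_mul_monomial, one_mul]
    congr 2
    ext k
    simp only [Finsupp.coe_add, Pi.add_apply, Finsupp.equivFunOnFinite_symm_apply_apply, Finset.filter_insert]
    by_cases hk : f a = k.val
    · rw [if_pos hk, Finset.card_insert_of_notMem (by simp [ha])]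
      have : (⟨f a, h⟩ : Fin m) = k := Fin.ext hk
      rw [this]; simp [add_comm]
    · rw [if_neg hk]
      have : (⟨f a, h⟩ : Fin m) ≠ k := fun h' => hk (by rw [← h'])
      simp [this]

theorem kg_coeff_S (m : ℕ) (lam : YoungDiagram) (d : Fin m →₀ ℕ) :
    MvPowerSeries.coeff d (kg_S (kg_X m) m lam) = (schurCoeff m lam d : ℚ) := by
  classical
  have h : {T : ℕ → ℕ → ℕ | IsSSYT m lam T ∧
    ∀ k : Fin m, d k = (lam.cells.filter fun c => T c.1 c.2 = k.val).card}
    = ((kg_tabs m lam).filter fun T => ∀ k : Fin m, d k = (lam.cells.filter fun c => T c.1 c.2 = k.val).card : Finset _) := by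
    ext T
    simp [kg_mem_tabs]
  rw [schurCoeff, h, Set.ncard_coe_finset, kg_S, map_sum, Finset.card_filter, Nat.cast_sum]
  refine Finset.sum_congr rfl fun T hT => ?_
  rw [kg_mem_tabs] at hT
  rw [kg_prod_X (fun c => T c.1 c.2) lam.cells (fun c hc => hT.1 c.1 c.2 hc), MvPowerSeries.coeff_monomial]
  simp only [Finsupp.ext_iff, Finsupp.equivFunOnFinite_symm_apply_apply]
  split_ifs <;> simp

theorem kg_schurCoeff_deg {m : ℕ} {lam : YoungDiagram} {d : Fin m →₀ ℕ} (h : schurCoeff m lam d ≠ 0) :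
    lam.colLen 0 ≤ m ∧ lam.cells.card = ∑ k, d k := by
  classical
  obtain ⟨T, hT, hd⟩ := Set.nonempty_of_ncard_ne_zero h
  constructor
  · by_contra hc
    have := kg_tabs_empty (not_le.1 hc)
    rw [← kg_mem_tabs, this] at hT
    simp at hT
  · simp only [hd]
    rw [Fin.sum_univ_eq_sum_range (fun k => (lam.cells.filter fun c => T c.1 c.2 = k).card) m]
    apply Finset.card_eq_sum_card_fiberwise
    intro c hc
    simpa using hT.1 c.1 c.2 hc

theorem kg_coeff_schurSum (m : ℕ) (S : Set YoungDiagram) (c : YoungDiagram → ℚ) (d : Fin m →₀ ℕ) :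
    MvPowerSeries.coeff d (schurSum m S c) = ∑' lam, S.indicator (fun lam => c lam * (schurCoeff m lam d : ℚ)) lam := by
  rw [← tsum_subtype]; rfl

theorem kg_schurSum_fin {m : ℕ} {S : Set YoungDiagram} (c : YoungDiagram → ℚ) (A : Finset YoungDiagram)
    (h1 : ∀ lam ∈ A, lam ∈ S) (h2 : ∀ lam ∈ S, lam.colLen 0 ≤ m → lam ∈ A) :
    schurSum m S c = ∑ lam ∈ A, MvPowerSeries.C (c lam) * kg_S (kg_X m) m lam := by
  ext d
  rw [kg_coeff_schurSum, tsum_eq_sum (s := A), map_sum]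
  · refine Finset.sum_congr rfl fun lam hl => ?_
    rw [Set.indicator_of_mem (h1 lam hl), MvPowerSeries.coeff_C_mul, kg_coeff_S]
  · intro lam hl
    by_cases hS : lam ∈ S
    · rw [Set.indicator_of_mem hS]
      by_cases hz : schurCoeff m lam d = 0
      · simp [hz]
      · exact absurd (h2 lam hS (kg_schurCoeff_deg hz).1) hl
    · rw [Set.indicator_of_notMem hS]

theorem kg_rowLen_le_card (lam : YoungDiagram) (i : ℕ) : lam.rowLen i ≤ lam.cells.card := by
  rw [YoungDiagram.rowLen_eq_card]
  exact Finset.card_le_card (Finset.filter_subset _ _)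

theorem kg_coeff_univ {m p : ℕ} {d : Fin m →₀ ℕ} (h : ∑ k, d k ≤ p) :
    MvPowerSeries.coeff d (schurSum m Set.univ (fun _ => 1))
      = MvPowerSeries.coeff d (schurSum m {lam : YoungDiagram | lam.rowLen 0 ≤ p} (fun _ => 1)) := by
  rw [kg_coeff_schurSum, kg_coeff_schurSum]
  congr 1
  funext lam
  rw [Set.indicator_univ]
  by_cases hl : lam.rowLen 0 ≤ p
  · rw [Set.indicator_of_mem (by exact hl)]
  · rw [Set.indicator_of_notMem (by exact hl)]
    by_cases hz : schurCoeff m lam d = 0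
    · simp [hz]
    · have := (kg_schurCoeff_deg hz).2
      have := kg_rowLen_le_card lam 0
      omega

theorem kg_rank_pos {lam : YoungDiagram} (h : lam ≠ ⊥) : 0 < frobRank lam ∧ 0 < lam.colLen 0 := by
  have h0 : (0, 0) ∈ lam := by
    by_contra hc
    apply h
    apply kg_ext
    intro i j
    constructor
    · intro hm
      exact absurd (lam.up_left_mem (Nat.zero_le i) (Nat.zero_le j) hm) hc
    · intro hm
      simp at hm
  constructor
  · rw [frobRank, Finset.card_pos]
    exact ⟨(0, 0), by simpa using h0⟩
  · exact YoungDiagram.mem_iff_lt_colLen.1 h0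

theorem kg_coeff_frob {m p : ℕ} {d : Fin m →₀ ℕ} (h : ∑ k, d k ≤ p) (g : YoungDiagram → ℕ) (hg : g ⊥ = 0) :
    MvPowerSeries.coeff d (schurSum m (frobSet p) (fun lam => (-1 : ℚ)^(g lam)))
      = MvPowerSeries.coeff d (1 : MvPowerSeries (Fin m) ℚ) := by
  rw [kg_coeff_schurSum, tsum_eq_single ⊥]
  · rw [Set.indicator_of_mem]
    · rw [hg, ← kg_coeff_S, kg_S, kg_tabs_bot]
      simp
    · intro k hk
      simp [frobRank] at hk
  · intro lam hl
    by_cases hS : lam ∈ frobSet p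
    · rw [Set.indicator_of_mem hS]
      by_cases hz : schurCoeff m lam d = 0
      · simp [hz]
      · have := (kg_schurCoeff_deg hz).2
        have := kg_rowLen_le_card lam 0
        have a := kg_rank_pos hl
        have := hS 0 a.1
        omega
    · rw [Set.indicator_of_notMem hS]

theorem kg_F_alt (m p : ℕ) :
    schurSum m {lam : YoungDiagram | lam.rowLen 0 ≤ p} (fun _ => 1) *
      kg_alt (fun i : Fin m => kg_X m i) (fun i => (i : ℕ)) = kg_G (m + p) (fun i : Fin m => kg_X m i) := by
  classical
  have hfin : {lam : YoungDiagram | lam.rowLen 0 ≤ p ∧ lam.colLen 0 ≤ m}.Finite := by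
    apply Set.Finite.of_finite_image (f := kg_exps m)
    · apply Set.Finite.subset (Finset.finite_toSet (kg_seq m (m+p)))
      rintro _ ⟨lam, ⟨h1, h2⟩, rfl⟩
      rw [Finset.mem_coe, kg_mem_seq]
      refine ⟨fun i => ?_, kg_exps_strict m lam⟩
      have := lam.rowLen_anti 0 (m-1-i) (Nat.zero_le _)
      simp only [kg_exps]
      omega
    · intro lam h1 mu h2 he
      exact kg_exps_inj h1.2 h2.2 he
  rw [kg_schurSum_fin _ hfin.toFinset (by intro lam h; simp at h; exact h.1)
    (by intro lam h1 h2; simp; exact ⟨h1, h2⟩), Finset.sum_mul, kg_G]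
  refine Finset.sum_bij (fun lam _ => kg_exps m lam) ?_ ?_ ?_ ?_
  · intro lam h
    simp at h
    rw [kg_mem_seq]
    refine ⟨fun i => ?_, kg_exps_strict m lam⟩
    have := lam.rowLen_anti 0 (m-1-i) (Nat.zero_le _)
    simp only [kg_exps]
    omega
  · intro lam h1 mu h2 he
    simp at h1 h2
    exact kg_exps_inj h1.2 h2.2 he
  · intro k hk
    rw [kg_mem_seq] at hk
    obtain ⟨lam, h1, rfl⟩ := kg_exps_surj hk.2
    refine ⟨lam, ?_, rfl⟩
    simp
    refine ⟨?_, h1⟩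
    rcases Nat.eq_zero_or_pos m with rfl | hm
    · rw [kg_row_zero.1 h1]; omega
    · have := hk.1 ⟨m-1, by omega⟩
      simp only [kg_exps, Nat.sub_self] at this
      omega
  · intro lam h
    simp at h
    rw [map_one, one_mul, kg_bialt _ _ _ h.2]


/-! ### Alternating functions -/

theorem kg_alt_sum {R : Type*} [CommRing R] {m : ℕ} (x : Fin m → R) (N : ℕ) :
    kg_D N x = ∑ b : Fin m → Bool, (∏ j, if b j then (-1 : R) else 1) *
      kg_alt x (fun j => if b j then N + m - 1 - j else j) := by
  have := (Matrix.detRowAlternating (n := Fin m) (R := R)).toMultilinearMap.map_sum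
    (fun (j : Fin m) (t : Bool) => fun i => (if t then (-1 : R) else 1) * x i ^ (if t then N + m - 1 - j else (j : ℕ)))
  simp only [AlternatingMap.coe_multilinearMap] at this
  refine Eq.trans ?_ (this.trans ?_)
  · rw [kg_D, ← Matrix.det_transpose]
    show Matrix.det _ = Matrix.det _
    congr 1; ext i j; simp; ring
  · refine Finset.sum_congr rfl fun b _ => ?_
    rw [kg_alt, ← Matrix.det_mul_row, ← Matrix.det_transpose]; rfl

def kg_IsAlt {R : Type*} [CommRing R] {m : ℕ} (Φ : (Fin m → ℕ) → R) : Prop :=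
  ∀ (π : Equiv.Perm (Fin m)) k, Φ (fun i => k (π i)) = ((Equiv.Perm.sign π : ℤ) : R) * Φ k

theorem kg_alt_isAlt {R : Type*} [CommRing R] {m : ℕ} (x : Fin m → R) : kg_IsAlt (kg_alt x) := by
  intro π k
  rw [kg_alt, kg_alt, ← Matrix.det_permute']
  rfl

theorem kg_isAlt_cons {R : Type*} [CommRing R] {m : ℕ} {Φ : (Fin (m+1) → ℕ) → R} (h : kg_IsAlt Φ) (a : ℕ)
    (π : Equiv.Perm (Fin m)) (k : Fin m → ℕ) :
    Φ (Fin.cons a (fun i => k (π i))) = ((Equiv.Perm.sign π : ℤ) : R) * Φ (Fin.cons a k) := by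
  have := h (Equiv.Perm.decomposeFin.symm (0, π)) (Fin.cons a k)
  rw [Equiv.Perm.decomposeFin.symm_sign] at this
  simp only [if_true, one_mul] at this
  rw [← this]
  congr 1
  funext i
  refine Fin.cases ?_ (fun i => ?_) i
  · simp
  · simp

theorem kg_isAlt_snoc {R : Type*} [CommRing R] {m : ℕ} {Φ : (Fin (m+1) → ℕ) → R} (h : kg_IsAlt Φ) (a : ℕ)
    (k : Fin m → ℕ) :
    Φ (Fin.snoc (α := fun _ => ℕ) k a) = (-1)^m * Φ (Fin.cons a k) := by
  rw [Fin.snoc_eq_cons_rotate, h (finRotate (m+1)) (Fin.cons a k), sign_finRotate]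
  simp

theorem kg_isAlt_step {R : Type*} [CommRing R] {m : ℕ} {Φ : (Fin (m+1) → ℕ) → R} (h : kg_IsAlt Φ) (a : ℕ) :
    kg_IsAlt (fun k : Fin m → ℕ => Φ (Fin.cons 0 (fun i => k i + 1)) - Φ (Fin.cons a (fun i => k i + 1))) := by
  intro π k
  simp only
  rw [kg_isAlt_cons h 0 π (fun i => k i + 1), kg_isAlt_cons h a π (fun i => k i + 1)]
  ring

/-! ### Frobenius recursion -/

theorem kg_rank_ex (lam : YoungDiagram) : ∃ r, ∀ k, (k, k) ∈ lam ↔ k < r := by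
  classical
  have hex : ∃ r, (r, r) ∉ lam := by
    refine ⟨lam.rowLen 0, fun h => ?_⟩
    have := lam.up_left_mem (Nat.zero_le _) le_rfl h
    rw [YoungDiagram.mem_iff_lt_rowLen] at this
    omega
  refine ⟨Nat.find hex, fun k => ⟨fun h => ?_, fun h => ?_⟩⟩
  · by_contra hc
    exact Nat.find_spec hex (lam.up_left_mem (not_lt.1 hc) (not_lt.1 hc) h)
  · by_contra hc
    exact absurd (Nat.find_min' hex hc) (by omega)

theorem kg_rank_eq {lam : YoungDiagram} {r : ℕ} (h : ∀ k, (k, k) ∈ lam ↔ k < r) : frobRank lam = r := by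
  classical
  have : lam.cells.filter (fun c => c.1 = c.2) = (Finset.range r).image (fun k => (k, k)) := by
    ext ⟨i, j⟩
    simp only [Finset.mem_filter, YoungDiagram.mem_cells, Finset.mem_image, Finset.mem_range, Prod.mk.injEq]
    constructor
    · rintro ⟨h1, rfl⟩
      exact ⟨i, (h i).1 h1, rfl, rfl⟩
    · rintro ⟨k, hk, rfl, rfl⟩
      exact ⟨(h k).2 hk, rfl⟩
  rw [frobRank, this, Finset.card_image_of_injective _ (fun a b hab => (Prod.mk.inj hab).1), Finset.card_range]

theorem kg_rank_iff {lam : YoungDiagram} {k : ℕ} : k < frobRank lam ↔ (k, k) ∈ lam := by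
  obtain ⟨r, hr⟩ := kg_rank_ex lam
  rw [kg_rank_eq hr, hr]

def kg_efun (p m : ℕ) (mu : YoungDiagram) : ℕ → ℕ
  | 0 => m + 1 + p
  | i + 1 => if i < m then min (mu.rowLen i) (m + p) + 1 else 0

theorem kg_efun_anti (p m : ℕ) (mu : YoungDiagram) : Antitone (kg_efun p m mu) := by
  apply antitone_nat_of_succ_le
  intro i
  cases i with
  | zero => simp only [kg_efun]; split_ifs <;> omega
  | succ i =>
    have := mu.rowLen_anti i (i+1) (by omega)
    simp only [kg_efun]; split_ifs <;> omega

def kg_extend (p m : ℕ) (mu : YoungDiagram) : YoungDiagram :=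
  kg_mk (kg_efun p m mu) (kg_efun_anti p m mu) (m + 1)

theorem kg_extend_row (p m : ℕ) (mu : YoungDiagram) (i : ℕ) :
    (kg_extend p m mu).rowLen i = kg_efun p m mu i :=
  kg_rowLen_mk (by simp [kg_efun]) i

theorem kg_extend_colLen (p m : ℕ) (mu : YoungDiagram) : (kg_extend p m mu).colLen 0 = m + 1 := by
  apply kg_colLen_eq
  intro i
  rw [YoungDiagram.mem_iff_lt_rowLen, kg_extend_row]
  cases i with
  | zero => simp only [kg_efun]; omega
  | succ i => simp only [kg_efun]; split_ifs <;> omega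

theorem kg_frob_row {p m : ℕ} {mu : YoungDiagram} (h : mu ∈ frobSet p) (hm : mu.colLen 0 ≤ m) (i : ℕ) :
    mu.rowLen i ≤ m + p := by
  have h1 := mu.rowLen_anti 0 i (Nat.zero_le i)
  by_cases h0 : mu = ⊥
  · subst h0
    have : YoungDiagram.rowLen ⊥ i = 0 := kg_rowLen_eq (by simp)
    omega
  · have := h 0 (kg_rank_pos h0).1
    omega

theorem kg_extend_row_succ {p m : ℕ} {mu : YoungDiagram} (h : mu ∈ frobSet p) (hm : mu.colLen 0 ≤ m) {i : ℕ}
    (hi : i < m) : (kg_extend p m mu).rowLen (i+1) = mu.rowLen i + 1 := by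
  rw [kg_extend_row]
  have := kg_frob_row h hm i
  simp only [kg_efun, if_pos hi]
  omega

theorem kg_extend_mem_succ {p m : ℕ} {mu : YoungDiagram} (h : mu ∈ frobSet p) (hm : mu.colLen 0 ≤ m) {i j : ℕ} :
    (i+1, j+1) ∈ kg_extend p m mu ↔ (i, j) ∈ mu := by
  rw [YoungDiagram.mem_iff_lt_rowLen, YoungDiagram.mem_iff_lt_rowLen]
  by_cases hi : i < m
  · rw [kg_extend_row_succ h hm hi]; omega
  · rw [kg_extend_row, kg_row_zero' hm (not_lt.1 hi)]
    simp only [kg_efun, if_neg hi]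
    omega

theorem kg_extend_mem_zero {p m : ℕ} {mu : YoungDiagram} {j : ℕ} :
    (0, j) ∈ kg_extend p m mu ↔ j < m + 1 + p := by
  rw [YoungDiagram.mem_iff_lt_rowLen, kg_extend_row]
  simp only [kg_efun]

theorem kg_extend_rank {p m : ℕ} {mu : YoungDiagram} (h : mu ∈ frobSet p) (hm : mu.colLen 0 ≤ m) :
    frobRank (kg_extend p m mu) = frobRank mu + 1 := by
  apply kg_rank_eq
  intro k
  cases k with
  | zero => rw [kg_extend_mem_zero]; omega
  | succ k => rw [kg_extend_mem_succ h hm, ← kg_rank_iff]; omega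

theorem kg_extend_card {p m : ℕ} {mu : YoungDiagram} (h : mu ∈ frobSet p) (hm : mu.colLen 0 ≤ m) :
    (kg_extend p m mu).cells.card = mu.cells.card + 2 * m + 1 + p := by
  rw [kg_card (kg_extend_colLen p m mu).le, kg_card hm, Finset.sum_range_succ']
  rw [Finset.sum_congr rfl (fun i hi => kg_extend_row_succ h hm (Finset.mem_range.1 hi)),
    Finset.sum_add_distrib, kg_extend_row]
  simp [kg_efun]
  omega

theorem kg_extend_frob {p m : ℕ} {mu : YoungDiagram} (h : mu ∈ frobSet p) (hm : mu.colLen 0 ≤ m) :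
    kg_extend p m mu ∈ frobSet p := by
  intro k hk
  rw [kg_extend_rank h hm] at hk
  cases k with
  | zero => rw [kg_extend_row, kg_extend_colLen]; simp only [kg_efun]
  | succ k =>
    have hk' : k < frobRank mu := by omega
    have hkm : (k, k) ∈ mu := kg_rank_iff.1 hk'
    have hk0 : (k, 0) ∈ mu := mu.up_left_mem le_rfl (Nat.zero_le _) hkm
    rw [YoungDiagram.mem_iff_lt_colLen] at hk0
    have hlt : k < m := by omega
    rw [kg_extend_row_succ h hm hlt, h k hk']
    have : (kg_extend p m mu).colLen (k+1) = mu.colLen k + 1 := by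
      apply kg_colLen_eq
      intro i
      cases i with
      | zero => rw [kg_extend_mem_zero]; omega
      | succ i => rw [kg_extend_mem_succ h hm, YoungDiagram.mem_iff_lt_colLen]; omega
    omega

theorem kg_extend_surj {p m : ℕ} {lam : YoungDiagram} (h : lam ∈ frobSet p) (hm : lam.colLen 0 = m + 1) :
    ∃ mu : YoungDiagram, mu ∈ frobSet p ∧ mu.colLen 0 ≤ m ∧ kg_extend p m mu = lam := by
  let f : ℕ → ℕ := fun i => lam.rowLen (i+1) - 1
  have hf : Antitone f := by
    intro a b hab
    have := lam.rowLen_anti (a+1) (b+1) (by omega)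
    simp only [f]; omega
  have hfm : f m = 0 := by
    simp only [f]
    rw [kg_row_zero' hm.le le_rfl]
  have hrow := kg_rowLen_mk (hf := hf) hfm
  have hmem : ∀ i j, (i, j) ∈ kg_mk f hf m ↔ (i+1, j+1) ∈ lam := by
    intro i j
    rw [kg_mem_mk hfm, YoungDiagram.mem_iff_lt_rowLen]
    simp only [f]; omega
  have h0 : lam.rowLen 0 = m + 1 + p := by
    have hne : lam ≠ ⊥ := by
      rintro rfl
      have : YoungDiagram.colLen ⊥ 0 = 0 := kg_colLen_eq (by simp)
      omega
    rw [h 0 (kg_rank_pos hne).1, hm]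
  have hc : (kg_mk f hf m).colLen 0 ≤ m := by rw [kg_row_zero, hrow, hfm]
  have hF : kg_mk f hf m ∈ frobSet p := by
    intro k hk
    rw [kg_rank_iff, hmem] at hk
    have h1 := h (k+1) (kg_rank_iff.2 hk)
    have : (kg_mk f hf m).colLen k = lam.colLen (k+1) - 1 := by
      apply kg_colLen_eq
      intro i
      rw [hmem, YoungDiagram.mem_iff_lt_colLen]; omega
    have h2 := YoungDiagram.mem_iff_lt_colLen.1 hk
    rw [hrow, this]
    simp only [f]
    omega
  refine ⟨_, hF, hc, ?_⟩
  apply kg_ext_row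
  intro i
  cases i with
  | zero => rw [kg_extend_row, h0]; simp only [kg_efun]
  | succ i =>
    by_cases hi : i < m
    · rw [kg_extend_row_succ hF hc hi, hrow]
      have : (i+1, 0) ∈ lam := YoungDiagram.mem_iff_lt_colLen.2 (by omega)
      rw [YoungDiagram.mem_iff_lt_rowLen] at this
      simp only [f]; omega
    · rw [kg_extend_row, kg_row_zero' hm.le (by omega)]
      simp only [kg_efun, if_neg hi]

theorem kg_extend_inj {p m : ℕ} {mu nu : YoungDiagram} (h : mu ∈ frobSet p) (hm : mu.colLen 0 ≤ m)
    (h' : nu ∈ frobSet p) (hm' : nu.colLen 0 ≤ m) (he : kg_extend p m mu = kg_extend p m nu) : mu = nu := by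
  apply kg_ext
  intro i j
  rw [← kg_extend_mem_succ h hm, he, kg_extend_mem_succ h' hm']

open Classical in
def kg_F (p : ℕ) : ℕ → Finset YoungDiagram
  | 0 => {⊥}
  | m + 1 => kg_F p m ∪ (kg_F p m).image (kg_extend p m)

theorem kg_mem_F (p m : ℕ) (lam : YoungDiagram) : lam ∈ kg_F p m ↔ lam ∈ frobSet p ∧ lam.colLen 0 ≤ m := by
  classical
  induction m generalizing lam with
  | zero =>
    simp only [kg_F, Finset.mem_singleton]
    constructor
    · rintro rfl
      refine ⟨?_, (kg_colLen_eq (by simp)).le⟩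
      intro k hk
      simp [frobRank] at hk
    · rintro ⟨_, h⟩
      by_contra hc
      have := (kg_rank_pos hc).2
      omega
  | succ m ih =>
    simp only [kg_F, Finset.mem_union, Finset.mem_image, ih]
    constructor
    · rintro (⟨h1, h2⟩ | ⟨mu, ⟨h1, h2⟩, rfl⟩)
      · exact ⟨h1, by omega⟩
      · exact ⟨kg_extend_frob h1 h2, (kg_extend_colLen p m mu).le⟩
    · rintro ⟨h1, h2⟩
      rcases Nat.lt_or_ge m (lam.colLen 0) with h | h
      · obtain ⟨mu, a, b, c⟩ := kg_extend_surj h1 (show lam.colLen 0 = m + 1 by omega)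
        exact Or.inr ⟨mu, ⟨a, b⟩, c⟩
      · exact Or.inl ⟨h1, h⟩

theorem kg_F_card (p m : ℕ) (lam : YoungDiagram) (h : lam ∈ kg_F p m) :
    frobRank lam * (p-1) ≤ lam.cells.card := by
  classical
  induction m generalizing lam with
  | zero =>
    simp only [kg_F, Finset.mem_singleton] at h
    subst h
    simp [frobRank]
  | succ m ih =>
    simp only [kg_F, Finset.mem_union, Finset.mem_image] at h
    rcases h with h | ⟨mu, h, rfl⟩
    · exact ih lam h
    · have h1 := ih mu h
      rw [kg_mem_F] at h
      rw [kg_extend_rank h.1 h.2, kg_extend_card h.1 h.2, add_mul]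
      omega

def kg_sg (p : ℕ) (lam : YoungDiagram) : ℕ := (lam.cells.card - frobRank lam * (p-1))/2

theorem kg_sg_extend {p m : ℕ} (hp : 0 < p) {mu : YoungDiagram} (h : mu ∈ kg_F p m) :
    kg_sg p (kg_extend p m mu) = kg_sg p mu + (m + 1) := by
  have h1 := kg_F_card p m mu h
  rw [kg_mem_F] at h
  rw [kg_sg, kg_sg, kg_extend_rank h.1 h.2, kg_extend_card h.1 h.2, add_mul]
  omega

theorem kg_exps_succ {m : ℕ} {mu : YoungDiagram} (h : mu.colLen 0 ≤ m) :
    kg_exps (m+1) mu = Fin.cons 0 (fun i => kg_exps m mu i + 1) := by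
  funext i
  refine Fin.cases ?_ (fun i => ?_) i
  · simp [kg_exps, kg_row_zero.1 h]
  · simp only [kg_exps, Fin.cons_succ, Fin.val_succ]
    rw [show m + 1 - 1 - (i.val + 1) = m - 1 - i by omega]
    omega

theorem kg_exps_extend {p m : ℕ} {mu : YoungDiagram} (h : mu ∈ frobSet p) (hm : mu.colLen 0 ≤ m) :
    kg_exps (m+1) (kg_extend p m mu) = Fin.snoc (α := fun _ => ℕ) (fun i => kg_exps m mu i + 1) (2 * m + 1 + p) := by
  funext i
  refine Fin.lastCases ?_ (fun i => ?_) i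
  · simp [kg_exps, kg_extend_row, kg_efun]; omega
  · simp only [kg_exps, Fin.snoc_castSucc, Fin.val_castSucc]
    rw [show m + 1 - 1 - i.val = (m - 1 - i) + 1 by omega, kg_extend_row_succ h hm (by omega)]
    omega

theorem kg_F_sum {R : Type*} [CommRing R] {p : ℕ} (hp : 0 < p) (m : ℕ) : ∀ Φ : (Fin m → ℕ) → R, kg_IsAlt Φ →
    ∑ lam ∈ kg_F p m, (-1 : R)^(kg_sg p lam) * Φ (kg_exps m lam)
      = ∑ b : Fin m → Bool, (∏ j, if b j then (-1 : R) else 1) *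
          Φ (fun j => if b j then m + p + m - 1 - j else j) := by
  classical
  induction m with
  | zero =>
    intro Φ _
    simp only [kg_F, Finset.sum_singleton, Finset.univ_unique, Finset.univ_eq_empty, Finset.prod_empty, one_mul]
    rw [show kg_sg p ⊥ = 0 by simp [kg_sg], pow_zero, one_mul]
    congr 1
    funext i
    exact i.elim0
  | succ m ih =>
    intro Φ hΦ
    rw [kg_F, Finset.sum_union, Finset.sum_image, ← Finset.sum_add_distrib]
    · have e1 : ∀ mu ∈ kg_F p m, (-1 : R)^(kg_sg p mu) * Φ (kg_exps (m+1) mu) +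
          (-1 : R)^(kg_sg p (kg_extend p m mu)) * Φ (kg_exps (m+1) (kg_extend p m mu))
          = (-1 : R)^(kg_sg p mu) * (fun k : Fin m → ℕ => Φ (Fin.cons 0 (fun i => k i + 1))
              - Φ (Fin.cons (2*m+1+p) (fun i => k i + 1))) (kg_exps m mu) := by
        intro mu hmu
        rw [kg_sg_extend hp hmu]
        rw [kg_mem_F] at hmu
        rw [kg_exps_succ hmu.2, kg_exps_extend hmu.1 hmu.2, kg_isAlt_snoc hΦ]
        have : (-1 : R)^m * (-1)^m = 1 := by rw [← mul_pow]; simp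
        simp only [pow_add]
        linear_combination (-(-1 : R)^(kg_sg p mu) * Φ (Fin.cons (2*m+1+p) (fun i => kg_exps m mu i + 1))) * this
      rw [Finset.sum_congr rfl e1, ih _ (kg_isAlt_step hΦ _)]
      rw [← (Fin.consEquiv (fun _ : Fin (m+1) => Bool)).sum_comp, Fintype.sum_prod_type, Fintype.sum_bool,
        ← Finset.sum_add_distrib]
      refine Finset.sum_congr rfl fun b _ => ?_
      simp only [Fin.consEquiv_apply, Fin.prod_univ_succ, Fin.cons_zero, Fin.cons_succ]
      have e2 : ∀ t : Bool, (fun j : Fin (m+1) => if (Fin.cons t b : Fin (m+1) → Bool) j then m + 1 + p + (m + 1) - 1 - (j : ℕ) else j)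
          = Fin.cons (if t then 2 * m + 1 + p else 0) (fun i : Fin m => (if b i then m + p + m - 1 - (i : ℕ) else i) + 1) := by
        intro t
        funext j
        refine Fin.cases ?_ (fun j => ?_) j
        · simp only [Fin.cons_zero, Fin.val_zero]
          split_ifs <;> omega
        · simp only [Fin.cons_succ, Fin.val_succ]
          split_ifs <;> omega
      rw [e2 true, e2 false]
      simp
      ring
    · intro mu hmu nu hnu he
      simp only [Finset.mem_coe, kg_mem_F] at hmu hnu
      exact kg_extend_inj hmu.1 hmu.2 hnu.1 hnu.2 he
    · rw [Finset.disjoint_left]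
      intro lam h1 h2
      rw [Finset.mem_image] at h2
      obtain ⟨mu, _, rfl⟩ := h2
      rw [kg_mem_F, kg_extend_colLen] at h1
      omega

theorem kg_Q_alt (m p : ℕ) (hp : 0 < p) :
    schurSum m (frobSet p) (fun lam => (-1 : ℚ)^((lam.cells.card - frobRank lam * (p-1))/2)) *
      kg_alt (fun i : Fin m => kg_X m i) (fun i => (i : ℕ)) = kg_D (m + p) (fun i : Fin m => kg_X m i) := by
  rw [kg_schurSum_fin _ (kg_F p m) (fun lam h => ((kg_mem_F p m lam).1 h).1)
    (fun lam h1 h2 => (kg_mem_F p m lam).2 ⟨h1, h2⟩), Finset.sum_mul, kg_alt_sum,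
    ← kg_F_sum hp m _ (kg_alt_isAlt _)]
  refine Finset.sum_congr rfl fun lam h => ?_
  rw [kg_mem_F] at h
  rw [mul_assoc, kg_bialt _ _ _ h.2, map_pow, map_neg, map_one, kg_sg]

/-! ### Conclusion -/

theorem kg_X_inj (m : ℕ) : Function.Injective (fun i : Fin m => kg_X m i) := by
  intro i j h
  simpa [kg_X, MvPowerSeries.X_inj] using h

theorem kg_domain (m : ℕ) : IsDomain (MvPowerSeries (Fin m) ℚ) :=
  NoZeroDivisors.to_isDomain _

theorem kg_alt_ne (m : ℕ) : kg_alt (fun i : Fin m => kg_X m i) (fun i => (i : ℕ)) ≠ 0 := by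
  have := kg_domain m
  show (Matrix.vandermonde _).det ≠ 0
  rw [Matrix.det_vandermonde_ne_zero_iff]
  exact kg_X_inj m

theorem kg_D_series (m N : ℕ) :
    kg_D N (fun i : Fin m => kg_X m i) = kg_B (fun i : Fin m => kg_X m i) * kg_G N (fun i : Fin m => kg_X m i) := by
  have := kg_domain m
  let K := FractionRing (MvPowerSeries (Fin m) ℚ)
  have hinj : Function.Injective (algebraMap (MvPowerSeries (Fin m) ℚ) K) := IsFractionRing.injective _ _
  apply hinj
  have h := kg_D_eq (K := K) (by
      have : (2 : K) = algebraMap (MvPowerSeries (Fin m) ℚ) K 2 := (map_ofNat _ 2).symm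
      rw [this, Ne, map_eq_zero_iff _ hinj]
      intro hc
      have := congrArg (MvPowerSeries.constantCoeff) hc
      rw [map_ofNat, map_zero] at this
      norm_num at this) m (fun i => algebraMap (MvPowerSeries (Fin m) ℚ) K (kg_X m i)) N (by
      intro i
      rw [Ne, map_eq_zero_iff _ hinj]
      simp only [kg_X, Fin.is_lt, dif_pos]
      intro hc
      have := congrArg (MvPowerSeries.coeff (Finsupp.single i 1)) hc
      rw [MvPowerSeries.coeff_index_single_self_X, map_zero] at this
      exact one_ne_zero this) (by
      intro i
      rw [← map_one (algebraMap (MvPowerSeries (Fin m) ℚ) K), ← map_add, Ne, map_eq_zero_iff _ hinj]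
      intro hc
      have := congrArg (MvPowerSeries.constantCoeff) hc
      simp [kg_X] at this)
  have e1 : ∀ k : Fin m → ℕ, algebraMap (MvPowerSeries (Fin m) ℚ) K (kg_alt (fun i : Fin m => kg_X m i) k)
      = kg_alt (fun i : Fin m => algebraMap (MvPowerSeries (Fin m) ℚ) K (kg_X m i)) k := by
    intro k
    rw [kg_alt, RingHom.map_det]
    congr 1
    ext i j
    simp
  rw [map_mul]
  have e2 : algebraMap (MvPowerSeries (Fin m) ℚ) K (kg_G N (fun i : Fin m => kg_X m i))
      = kg_G N (fun i : Fin m => algebraMap (MvPowerSeries (Fin m) ℚ) K (kg_X m i)) := by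
    simp only [kg_G, map_sum, e1]
  have e3 : algebraMap (MvPowerSeries (Fin m) ℚ) K (kg_B (fun i : Fin m => kg_X m i))
      = kg_B (fun i : Fin m => algebraMap (MvPowerSeries (Fin m) ℚ) K (kg_X m i)) := by
    simp [kg_B]
  rw [e2, e3, ← h, kg_D, RingHom.map_det]
  unfold kg_D
  congr 1
  ext i j
  simp

theorem kg_Q_eq (m p : ℕ) (hp : 0 < p) :
    schurSum m (frobSet p) (fun lam => (-1 : ℚ)^((lam.cells.card - frobRank lam * (p-1))/2))
    = kg_B (fun i : Fin m => kg_X m i) * schurSum m {lam : YoungDiagram | lam.rowLen 0 ≤ p} (fun _ => 1) := by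
  apply mul_right_cancel₀ (kg_alt_ne m)
  rw [kg_Q_alt m p hp, mul_assoc, kg_F_alt, kg_D_series]

theorem kg_S_inv (m : ℕ) :
    schurSum m Set.univ (fun _ => 1) * kg_B (fun i : Fin m => kg_X m i) = 1 := by
  classical
  ext d
  have h := kg_Q_eq m (∑ k, d k + 1) (by omega)
  rw [← kg_coeff_frob (p := ∑ k, d k + 1) (d := d) (by omega)
    (fun lam => (lam.cells.card - frobRank lam * (∑ k, d k + 1-1))/2) (by simp), h, mul_comm (kg_B _),
    MvPowerSeries.coeff_mul, MvPowerSeries.coeff_mul]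
  refine Finset.sum_congr rfl fun e he => ?_
  rw [kg_coeff_univ (p := ∑ k, d k + 1)]
  rw [Finset.HasAntidiagonal.mem_antidiagonal] at he
  subst he
  simp only [Finsupp.coe_add, Pi.add_apply, Finset.sum_add_distrib]
  omega

/-- King: for positive integers `p` and `m`, in ℚ[[x_1,…,x_m]]:
`(Σ_ν s_ν(x)) · (Σ_{σ∈P_p} (-1)^{(|σ|-r(σ)(p-1))/2} s_σ(x)) = Σ_{λ:λ_1≤p} s_λ(x)`. -/
theorem king_schur_identity (m p : ℕ) (hm : 0 < m) (hp : 0 < p) :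
    schurSum m Set.univ (fun _ => 1)
      * schurSum m (frobSet p)
          (fun lam => (-1 : ℚ)^((lam.cells.card - frobRank lam * (p-1))/2))
    = schurSum m {lam : YoungDiagram | lam.rowLen 0 ≤ p} (fun _ => 1) := by
  rw [kg_Q_eq m p hp, ← mul_assoc, kg_S_inv, one_mul]

end
end

section
/- Let μ = (μ_1,…,μ_r) and ν = (ν_1,…,ν_{r−1}) be tuples of nonnegative integers (r = m+n) satisfying: μ_j ≥ μ_{j+1} for 1 ≤ j ≤ r−1 with j ≠ m; μ_m ≥ #{i : m+1 ≤ i ≤ r, μ_i > 0}; θ_i := μ_i − ν_i ∈ {0,1} for 1 ≤ i ≤ m; ν_i ≥ ν_{i+1} for 1 ≤ i ≤ m−1; μ_s ≥ ν_s ≥ μ_{s+1} for m+1 ≤ s ≤ r−1; and ν_m ≥ #{i : m+1 ≤ i ≤ r−1, ν_i > 0}. Assume every factor occurring in a denominator below is nonzero (summands with prefactor (1−θ_i) = 0 or θ_i = 0 are taken to be zero). Then the explicit squared reduced matrix elements A_k satisfy the recurrence relation: Σ_{i=1}^m (1−θ_i)·[∏_{1≤j≤m, j≠i} (μ_i−μ_j−i+j+1)/(μ_i−ν_j−i+j)]·[∏_{s=m+1}^{r−1}(μ_i+ν_s+2m−i−s+1)]/[∏_{s=m+1}^{r}(μ_i+μ_s+2m−i−s+2)]·A_i(μ)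 + Σ_{i=1}^m θ_i·[∏_{1≤j≤m, j≠i}(μ_i−μ_j−i+j)/(μ_i−ν_j−i+j−1)]·[∏_{s=m+1}^{r−1}(μ_i+ν_s+2m−i−s)]/[∏_{s=m+1}^{r}(μ_i+μ_s+2m−i−s+1)]·A_i(μ_{−i}) + Σ_{q=m+1}^r [∏_{j=1}^m (μ_j+μ_q+2m−j−q+1)/(ν_j+μ_q+2m−j−q+2)]·[∏_{s=m+1}^{r−1}(μ_q−ν_s−q+s+1)]/[∏_{m+1≤s≤r, s≠q}(μ_q−μ_s−q+s)]·A_q(μ) + Σ_{q=m+1}^r [∏_{j=1}^m (μ_j+μ_q+2m−j−q)/(ν_j+μ_q+2m−j−q+1)]·[∏_{s=m+1}^{r−1}(μ_q−ν_s−q+s)]/[∏_{m+1≤s≤r, s≠q}(μ_q−μ_s−q+s−1)]·A_q(μ_{−q}) = p + 2(Σ_{i=1}^r μ_i − Σ_{i=1}^{r−1} ν_i), where μ_{−i} denotes the tuple μ with μ_i replaced by μ_i − 1. -/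
noncomputable section

open Finset

/-- `eParity a = 1` if the integer `a` is even and `0` otherwise (the function `E_a`). -/
def eParity (a : ℤ) : ℚ := if Even a then 1 else 0

/-- `oParity a = 1` if the integer `a` is odd and `0` otherwise (the function `O_a`). -/
def oParity (a : ℤ) : ℚ := if Even a then 0 else 1

/-- `Asq m n p μ k` is `A_k(μ) = G_k(μ)²`, the square of the reduced matrix
element `G_k` of the osp(2m+1|2n) representation `V(p)`, for a tuple
`μ = (μ 1, …, μ (m+n))` of integers (1-based indexing).  For `k ≤ m` the
formula depends on the parity of `k`; for `k = m + k'` with `1 ≤ k' ≤ n` it is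
the paraboson-type expression. -/
def Asq (m n p : ℕ) (μ : ℕ → ℤ) (k : ℕ) : ℚ :=
  if k ≤ m then
    if Even k then
      -(eParity (m : ℤ) * ((μ k : ℚ) + m - n - k) + 1)
        * (∏ j ∈ (Icc 1 m).filter (· ≠ k), ((μ k : ℚ) - (μ j : ℚ) - k + j))
        / (∏ j ∈ (Icc 1 (m/2)).filter (fun j => 2*j ≠ k),
            (((μ k : ℚ) - (μ (2*j) : ℚ) - k + 2*j)
              * ((μ k : ℚ) - (μ (2*j) : ℚ) - k + 2*j + 1)))
        * ∏ j ∈ Icc 1 n,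
            (((μ k : ℚ) + (μ (m+j) : ℚ) + m - j - k + 2)
              / ((μ k : ℚ) + (μ (m+j) : ℚ) + m - j - k + 2 - eParity ((m : ℤ) + μ (m+j))))
    else
      ((p : ℚ) - (μ k : ℚ) + k - 1)
        * (oParity (m : ℤ) * ((μ k : ℚ) + m - n - k) + 1)
        * (∏ j ∈ (Icc 1 m).filter (· ≠ k), ((μ k : ℚ) - (μ j : ℚ) - k + j))
        / (∏ j ∈ (Icc 1 ((m+1)/2)).filter (fun j => 2*j - 1 ≠ k),
            (((μ k : ℚ) - (μ (2*j-1) : ℚ) - k + 2*j - 1)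
              * ((μ k : ℚ) - (μ (2*j-1) : ℚ) - k + 2*j)))
        * ∏ j ∈ Icc 1 n,
            (((μ k : ℚ) + (μ (m+j) : ℚ) + m - j - k + 2)
              / ((μ k : ℚ) + (μ (m+j) : ℚ) + m - j - k + 2 - oParity ((m : ℤ) + μ (m+j))))
  else
    (oParity (μ k) * ((μ k : ℚ) - ((k - m : ℕ) : ℚ) + n) + 1)
      * (eParity ((m : ℤ) + μ k) * ((p : ℚ) + (μ k : ℚ) + m - ((k - m : ℕ) : ℚ)) + 1)
      * (∏ j ∈ Icc 1 (m/2),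
          (eParity ((m : ℤ) + μ k)
              * ((μ (2*j) : ℚ) + (μ k : ℚ) - 2*j - ((k - m : ℕ) : ℚ) + m + 1) + 1))
      / (∏ j ∈ Icc 1 ((m+1)/2),
          (eParity ((m : ℤ) + μ k)
              * ((μ (2*j-1) : ℚ) + (μ k : ℚ) - 2*j - ((k - m : ℕ) : ℚ) + m + 1) + 1))
      * (∏ j ∈ Icc 1 ((m+1)/2),
          (oParity ((m : ℤ) + μ k)
              * ((μ (2*j-1) : ℚ) + (μ k : ℚ) - 2*j - ((k - m : ℕ) : ℚ) + m + 2) + 1))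
      / (∏ j ∈ Icc 1 (m/2),
          (oParity ((m : ℤ) + μ k)
              * ((μ (2*j) : ℚ) + (μ k : ℚ) - 2*j - ((k - m : ℕ) : ℚ) + m) + 1))
      * ∏ j ∈ (Icc 1 n).filter (· ≠ k - m),
          (((μ (m+j) : ℚ) - (μ k : ℚ) - j + ((k - m : ℕ) : ℚ))
            / ((μ (m+j) : ℚ) - (μ k : ℚ) - j + ((k - m : ℕ) : ℚ)
                - oParity (μ (m+j) - μ k)))

/-- `AsqDenomOK m n p μ k` asserts that every factor occurring in a denominator
of `Asq m n p μ k` is nonzero. -/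
def AsqDenomOK (m n p : ℕ) (μ : ℕ → ℤ) (k : ℕ) : Prop :=
  if k ≤ m then
    if Even k then
      (∀ j ∈ (Icc 1 (m/2)).filter (fun j => 2*j ≠ k),
          ((μ k : ℚ) - (μ (2*j) : ℚ) - k + 2*j ≠ 0
            ∧ (μ k : ℚ) - (μ (2*j) : ℚ) - k + 2*j + 1 ≠ 0)) ∧
      (∀ j ∈ Icc 1 n,
          (μ k : ℚ) + (μ (m+j) : ℚ) + m - j - k + 2 - eParity ((m : ℤ) + μ (m+j)) ≠ 0)
    else
      (∀ j ∈ (Icc 1 ((m+1)/2)).filter (fun j => 2*j - 1 ≠ k),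
          ((μ k : ℚ) - (μ (2*j-1) : ℚ) - k + 2*j - 1 ≠ 0
            ∧ (μ k : ℚ) - (μ (2*j-1) : ℚ) - k + 2*j ≠ 0)) ∧
      (∀ j ∈ Icc 1 n,
          (μ k : ℚ) + (μ (m+j) : ℚ) + m - j - k + 2 - oParity ((m : ℤ) + μ (m+j)) ≠ 0)
  else
    (∀ j ∈ Icc 1 ((m+1)/2),
        eParity ((m : ℤ) + μ k)
            * ((μ (2*j-1) : ℚ) + (μ k : ℚ) - 2*j - ((k - m : ℕ) : ℚ) + m + 1) + 1 ≠ 0) ∧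
    (∀ j ∈ Icc 1 (m/2),
        oParity ((m : ℤ) + μ k)
            * ((μ (2*j) : ℚ) + (μ k : ℚ) - 2*j - ((k - m : ℕ) : ℚ) + m) + 1 ≠ 0) ∧
    (∀ j ∈ (Icc 1 n).filter (· ≠ k - m),
        (μ (m+j) : ℚ) - (μ k : ℚ) - j + ((k - m : ℕ) : ℚ) - oParity (μ (m+j) - μ k) ≠ 0)

/-- shifted coordinates -/
def sh (m : ℕ) (μ : ℕ → ℤ) (j : ℕ) : ℚ := (μ j : ℚ) + m - j

def dl (c m : ℕ) (μ : ℕ → ℤ) (s : ℕ) : ℚ :=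
  if c = 1 then oParity ((m : ℤ) + μ s) else eParity ((m : ℤ) + μ s)

def SS (c m : ℕ) : Finset ℕ := (Icc 1 m).filter (fun j => j % 2 = c)

def SN (c m : ℕ) : Finset ℕ := (Icc 1 m).filter (fun j => ¬ j % 2 = c)

def ef (c m n p : ℕ) (w : ℚ) : ℚ :=
  (if c = 1 then w - ((p : ℚ) + m - 1) else 1) * (if m % 2 = c then w - ((n : ℚ) - 1) else 1)

theorem lagrange_next (s : Finset ℕ) (hs : s.Nonempty) (v : ℕ → ℚ) (hv : Set.InjOn v s)
    (P : Polynomial ℚ) (hP : P.Monic) (hd : P.natDegree = s.card) :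
    ∑ i ∈ s, P.eval (v i) / ∏ j ∈ s.erase i, (v i - v j) = P.nextCoeff + ∑ i ∈ s, v i := by
  have hpos : 0 < s.card := hs.card_pos
  have hdeg : (P - Lagrange.nodal s v).degree < (s.card : WithBot ℕ) := by
    have h1 : P.degree = s.card := by
      rw [Polynomial.degree_eq_natDegree hP.ne_zero, hd]
    rw [← h1]
    apply Polynomial.degree_sub_lt_left
    · rw [h1, Lagrange.degree_nodal]
    · exact hP.ne_zero
    · rw [hP.leadingCoeff, (Lagrange.nodal_monic (s := s) (v := v)).leadingCoeff]
  have h := Lagrange.coeff_eq_sum hv hdeg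
  have h2 : ∀ i ∈ s, (P - Lagrange.nodal s v).eval (v i) / ∏ j ∈ s.erase i, (v i - v j)
      = P.eval (v i) / ∏ j ∈ s.erase i, (v i - v j) := by
    intro i hi
    rw [Polynomial.eval_sub, Lagrange.eval_nodal_at_node hi, sub_zero]
  rw [Finset.sum_congr rfl h2] at h
  rw [← h, Polynomial.coeff_sub, Polynomial.nextCoeff_of_natDegree_pos (by omega), hd,
    Lagrange.nodal_eq, Polynomial.prod_X_sub_C_coeff_card_pred _ _ hpos]
  ring

theorem prod_SS_zero (m : ℕ) (P : ℕ → Prop) [DecidablePred P] (f : ℕ → ℚ) :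
    ∏ j ∈ (Icc 1 (m/2)).filter (fun j => P (2*j)), f (2*j) = ∏ j ∈ (SS 0 m).filter P, f j := by
  refine Finset.prod_nbij' (fun j => 2*j) (fun j => j/2) ?_ ?_ ?_ ?_ ?_
  · intro j hj
    simp only [SS, mem_filter, mem_Icc] at hj ⊢
    exact ⟨by omega, hj.2⟩
  · intro j hj
    simp only [SS, mem_filter, mem_Icc] at hj ⊢
    refine ⟨by omega, ?_⟩
    rw [show 2*(j/2) = j by omega]; exact hj.2
  · intro j hj; simp
  · intro j hj
    simp only [SS, mem_filter, mem_Icc] at hj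
    show 2*(j/2) = j
    omega
  · intro j hj; rfl

theorem prod_SS_one (m : ℕ) (P : ℕ → Prop) [DecidablePred P] (f : ℕ → ℚ) :
    ∏ j ∈ (Icc 1 ((m+1)/2)).filter (fun j => P (2*j-1)), f (2*j-1)
      = ∏ j ∈ (SS 1 m).filter P, f j := by
  refine Finset.prod_nbij' (fun j => 2*j-1) (fun j => (j+1)/2) ?_ ?_ ?_ ?_ ?_
  · intro j hj
    simp only [SS, mem_filter, mem_Icc] at hj ⊢
    exact ⟨by omega, hj.2⟩
  · intro j hj
    simp only [SS, mem_filter, mem_Icc] at hj ⊢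
    refine ⟨by omega, ?_⟩
    rw [show 2*((j+1)/2)-1 = j by omega]; exact hj.2
  · intro j hj
    simp only [mem_filter, mem_Icc] at hj
    show (2*j-1+1)/2 = j
    omega
  · intro j hj
    simp only [SS, mem_filter, mem_Icc] at hj
    show 2*((j+1)/2)-1 = j
    omega
  · intro j hj; rfl

theorem prod_shift (m n : ℕ) (P : ℕ → Prop) [DecidablePred P] (f : ℕ → ℚ) :
    ∏ j ∈ (Icc 1 n).filter (fun j => P (m+j)), f (m+j)
      = ∏ s ∈ (Icc (m+1) (m+n)).filter P, f s := by
  refine Finset.prod_nbij' (fun j => m+j) (fun j => j-m) ?_ ?_ ?_ ?_ ?_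
  · intro j hj
    simp only [mem_filter, mem_Icc] at hj ⊢
    exact ⟨by omega, hj.2⟩
  · intro j hj
    simp only [mem_filter, mem_Icc] at hj ⊢
    refine ⟨by omega, ?_⟩
    rw [show m + (j-m) = j by omega]; exact hj.2
  · intro j hj; simp
  · intro j hj
    simp only [mem_filter, mem_Icc] at hj
    show m + (j-m) = j
    omega
  · intro j hj; rfl

theorem prod_split (c m : ℕ) (f : ℕ → ℚ) :
    ∏ j ∈ Icc 1 m, f j = (∏ j ∈ SS c m, f j) * ∏ j ∈ SN c m, f j :=
  (Finset.prod_filter_mul_prod_filter_not _ _ _).symm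

theorem prod_split_ne (c m k : ℕ) (hk : k ∈ SS c m) (f : ℕ → ℚ) :
    ∏ j ∈ (Icc 1 m).filter (· ≠ k), f j
      = (∏ j ∈ (SS c m).erase k, f j) * ∏ j ∈ SN c m, f j := by
  rw [← Finset.prod_filter_mul_prod_filter_not _ (fun j => j % 2 = c)]
  simp only [SS, mem_filter] at hk
  congr 1
  · apply Finset.prod_congr _ (fun _ _ => rfl)
    ext j; simp only [SS, mem_filter, mem_erase]; tauto
  · apply Finset.prod_congr _ (fun _ _ => rfl)
    ext j; simp only [SN, mem_filter]
    constructor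
    · tauto
    · rintro ⟨h1, h2⟩
      refine ⟨⟨h1, ?_⟩, h2⟩
      rintro rfl
      exact h2 hk.2

theorem filter_ne_erase (s : Finset ℕ) (k : ℕ) : s.filter (· ≠ k) = s.erase k :=
  Finset.filter_ne' s k

theorem Asq_low (c m n p : ℕ) (hc : c = 0 ∨ c = 1) (μ : ℕ → ℤ) (k : ℕ) (hk : k ∈ SS c m) :
    Asq m n p μ k = -(ef c m n p (sh m μ k))
      * ((∏ j ∈ (SS c m).erase k, (sh m μ k - sh m μ j)) * ∏ j ∈ SN c m, (sh m μ k - sh m μ j))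
      / (∏ j ∈ (SS c m).erase k,
          ((sh m μ k - sh m μ j) * (sh m μ k - sh m μ j + 1)))
      * ∏ s ∈ Icc (m+1) (m+n),
          ((sh m μ k + sh m μ s + 2) / (sh m μ k + sh m μ s + 2 - dl c m μ s)) := by
  have hk' := hk
  simp only [SS, mem_filter, mem_Icc] at hk'
  have hT : ∀ f : ℕ → ℚ, ∏ s ∈ Icc (m+1) (m+n), f s = ∏ j ∈ Icc 1 n, f (m+j) := by
    intro f
    have := prod_shift m n (fun _ => True) f
    simpa using this.symm
  rw [← prod_split_ne c m k hk, ← filter_ne_erase, hT]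
  rcases hc with rfl | rfl
  · have hev : Even k := Nat.even_iff.mpr hk'.2
    rw [← prod_SS_zero]
    unfold Asq
    rw [if_pos hk'.1.2, if_pos hev]
    congr 1
    · congr 1
      · congr 1
        · unfold ef sh eParity
          by_cases h : m % 2 = 0
          · have : Even (m : ℤ) := by rw [Int.even_iff]; omega
            simp only [h, this, if_true]; norm_num; ring
          · have : ¬ Even (m : ℤ) := by rw [Int.even_iff]; omega
            simp [h, this]
        · apply Finset.prod_congr rfl; intro j _; unfold sh; ring
      · apply Finset.prod_congr rfl; intro j _; unfold sh; push_cast; ring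
    · apply Finset.prod_congr rfl; intro j _; unfold sh dl; push_cast
      congr 1 <;> ring
  · have hev : ¬ Even k := by rw [Nat.even_iff]; omega
    rw [← prod_SS_one]
    unfold Asq
    rw [if_pos hk'.1.2, if_neg hev]
    congr 1
    · congr 1
      · congr 1
        · unfold ef sh oParity
          by_cases h : m % 2 = 1
          · have : ¬ Even (m : ℤ) := by rw [Int.even_iff]; omega
            simp only [h, this, if_true, if_false]; ring
          · have : Even (m : ℤ) := by rw [Int.even_iff]; omega
            simp only [h, this, if_true, if_false]; ring
        · apply Finset.prod_congr rfl; intro j _; unfold sh; ring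
      · apply Finset.prod_congr rfl; intro j hj; unfold sh
        simp only [mem_filter, mem_Icc] at hj
        rw [Nat.cast_sub (by omega)]; push_cast; ring
    · apply Finset.prod_congr rfl; intro j _; unfold sh dl; push_cast
      congr 1 <;> ring

theorem DenomOK_low (c m n p : ℕ) (hc : c = 0 ∨ c = 1) (μ : ℕ → ℤ) (k : ℕ) (hk : k ∈ SS c m)
    (h : AsqDenomOK m n p μ k) :
    ∀ j ∈ (SS c m).erase k, sh m μ k - sh m μ j ≠ 0 ∧ sh m μ k - sh m μ j + 1 ≠ 0 := by
  intro j hj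
  simp only [SS, mem_filter, mem_Icc, mem_erase] at hk hj
  unfold AsqDenomOK at h
  rw [if_pos hk.1.2] at h
  rcases hc with rfl | rfl
  · rw [if_pos (Nat.even_iff.mpr hk.2)] at h
    have h1 := h.1 (j/2) (by simp only [mem_filter, mem_Icc]; omega)
    obtain ⟨t, rfl⟩ : ∃ t, j = 2*t := ⟨j/2, by omega⟩
    rw [show 2*t/2 = t by omega] at h1
    unfold sh; push_cast
    constructor
    · convert h1.1 using 1; ring
    · convert h1.2 using 1; ring
  · rw [if_neg (by rw [Nat.even_iff]; omega)] at h
    have h1 := h.1 (j/2+1) (by simp only [mem_filter, mem_Icc]; omega)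
    obtain ⟨t, rfl⟩ : ∃ t, j = 2*t+1 := ⟨j/2, by omega⟩
    rw [show (2*t+1)/2 = t by omega, show 2*(t+1)-1 = 2*t+1 by omega] at h1
    unfold sh; push_cast at h1 ⊢
    constructor
    · convert h1.1 using 1; ring
    · convert h1.2 using 1; ring

theorem SN_one (m : ℕ) : SN 1 m = SS 0 m := by
  ext j; simp only [SN, SS, mem_filter, mem_Icc]; omega

theorem SN_zero (m : ℕ) : SN 0 m = SS 1 m := by
  ext j; simp only [SN, SS, mem_filter, mem_Icc]; omega

theorem prod_SS_zero' (m : ℕ) (f : ℕ → ℚ) :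
    ∏ j ∈ Icc 1 (m/2), f (2*j) = ∏ j ∈ SS 0 m, f j := by
  have := prod_SS_zero m (fun _ => True) f
  simpa using this

theorem prod_SS_one' (m : ℕ) (f : ℕ → ℚ) :
    ∏ j ∈ Icc 1 ((m+1)/2), f (2*j-1) = ∏ j ∈ SS 1 m, f j := by
  have := prod_SS_one m (fun _ => True) f
  simpa using this

theorem prod_neg_div (c m : ℕ) (f g : ℕ → ℚ) :
    (∏ j ∈ SN c m, -(f j)) / (∏ j ∈ SS c m, -(g j))
      = (-1)^m * ((∏ j ∈ SN c m, f j) / ∏ j ∈ SS c m, g j) := by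
  have h : (-1 : ℚ)^m = (∏ j ∈ SS c m, (-1 : ℚ)) * ∏ j ∈ SN c m, (-1 : ℚ) := by
    rw [← prod_split c m]; simp
  have h1 : ∏ j ∈ SN c m, -(f j) = (∏ j ∈ SN c m, (-1 : ℚ)) * ∏ j ∈ SN c m, f j := by
    rw [← Finset.prod_mul_distrib]; apply Finset.prod_congr rfl; intros; ring
  have h2 : ∏ j ∈ SS c m, -(g j) = (∏ j ∈ SS c m, (-1 : ℚ)) * ∏ j ∈ SS c m, g j := by
    rw [← Finset.prod_mul_distrib]; apply Finset.prod_congr rfl; intros; ring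
  have h3 : (∏ j ∈ SS c m, (-1 : ℚ))⁻¹ = ∏ j ∈ SS c m, (-1 : ℚ) := by
    rw [← Finset.prod_inv_distrib]; norm_num
  rw [h, h1, h2, div_eq_mul_inv, mul_inv, h3]; ring

theorem neg_one_pow_mod (m : ℕ) : ((-1 : ℚ))^m = if m % 2 = 0 then 1 else -1 := by
  split_ifs with h
  · exact (Nat.even_iff.mpr h).neg_one_pow
  · exact (Nat.odd_iff.mpr (by omega)).neg_one_pow

theorem par_relation (c m : ℕ) (hc : c = 0 ∨ c = 1) (μ : ℕ → ℤ) (q : ℕ)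
    (hcq : c = 1 ↔ Even ((m : ℤ) + μ q)) (s : ℕ) :
    oParity (μ s - μ q) = dl c m μ s := by
  unfold dl oParity eParity
  simp only [Int.even_iff] at hcq ⊢
  rcases hc with rfl | rfl
  · have : ¬ ((m + μ q) % 2 = 0) := by rw [← hcq]; simp
    by_cases h : (m + μ s) % 2 = 0
    · rw [if_neg (by omega), if_neg (by omega), if_pos h]
    · rw [if_pos (by omega), if_neg (by omega), if_neg h]
  · have : ((m + μ q) % 2 = 0) := by rw [← hcq]
    by_cases h : (m + μ s) % 2 = 0
    · rw [if_pos (by omega), if_pos rfl, if_pos h]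
    · rw [if_neg (by omega), if_pos rfl, if_neg h]

theorem Asq_high (c m n p : ℕ) (hc : c = 0 ∨ c = 1) (μ : ℕ → ℤ) (q : ℕ)
    (hq : q ∈ Icc (m+1) (m+n)) (hcq : c = 1 ↔ Even ((m : ℤ) + μ q)) (w : ℚ)
    (hw : w = -(sh m μ q) - 2) :
    Asq m n p μ q = -(ef c m n p w)
      * ((∏ j ∈ SN c m, (w - sh m μ j)) / (∏ j ∈ SS c m, (w - sh m μ j + 1)))
      * ∏ s ∈ (Icc (m+1) (m+n)).erase q,
          ((w + sh m μ s + 2) / (w + sh m μ s + 2 - dl c m μ s)) := by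
  simp only [mem_Icc] at hq
  have hlast : ∏ j ∈ (Icc 1 n).filter (· ≠ q - m),
          (((μ (m+j) : ℚ) - (μ q : ℚ) - j + ((q - m : ℕ) : ℚ))
            / ((μ (m+j) : ℚ) - (μ q : ℚ) - j + ((q - m : ℕ) : ℚ)
                - oParity (μ (m+j) - μ q)))
      = ∏ s ∈ (Icc (m+1) (m+n)).erase q,
          ((w + sh m μ s + 2) / (w + sh m μ s + 2 - dl c m μ s)) := by
    rw [← filter_ne_erase, ← prod_shift]
    have : (Icc 1 n).filter (· ≠ q - m) = (Icc 1 n).filter (fun j => m + j ≠ q) := by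
      ext j; simp only [mem_filter, mem_Icc]; omega
    rw [this]
    apply Finset.prod_congr rfl
    intro j _
    rw [par_relation c m hc μ q hcq, hw, Nat.cast_sub (by omega)]
    unfold sh; push_cast
    congr 1 <;> ring
  unfold Asq
  rw [if_neg (by omega), hlast]
  congr 1
  rw [Nat.cast_sub (by omega)]
  rcases hc with rfl | rfl
  · have hn : ¬ Even ((m : ℤ) + μ q) := by rw [← hcq]; simp
    have hE : eParity ((m : ℤ) + μ q) = 0 := by simp [eParity, hn]
    have hO : oParity ((m : ℤ) + μ q) = 1 := by simp [oParity, hn]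
    rw [hE, hO]
    have h1 : ∏ j ∈ Icc 1 ((m+1)/2), (1 * ((μ (2*j-1) : ℚ) + (μ q : ℚ) - 2*j - ((q : ℚ) - m) + m + 2) + 1)
        = ∏ j ∈ SN 0 m, -(w - sh m μ j) := by
      rw [SN_zero, ← prod_SS_one']
      apply Finset.prod_congr rfl
      intro j hj
      simp only [mem_Icc] at hj
      rw [hw]; unfold sh; rw [Nat.cast_sub (by omega)]; push_cast; ring
    have h2 : ∏ j ∈ Icc 1 (m/2), (1 * ((μ (2*j) : ℚ) + (μ q : ℚ) - 2*j - ((q : ℚ) - m) + m) + 1)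
        = ∏ j ∈ SS 0 m, -(w - sh m μ j + 1) := by
      rw [← prod_SS_zero']
      apply Finset.prod_congr rfl
      intro j hj
      rw [hw]; unfold sh; push_cast; ring
    rw [h1, h2, mul_div_assoc, prod_neg_div, neg_one_pow_mod]
    simp only [zero_mul, zero_add, Finset.prod_const_one, mul_one, div_one]
    rw [← mul_assoc]
    congr 1
    unfold ef oParity
    simp only [Int.even_iff] at hn ⊢
    by_cases h : m % 2 = 0
    · rw [if_neg (by omega), if_pos h, if_neg (by omega), if_pos h, hw]; unfold sh; ring
    · rw [if_pos (by omega), if_neg h, if_neg (by omega), if_neg h]; ring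
  · have hn : Even ((m : ℤ) + μ q) := by rw [← hcq]
    have hE : eParity ((m : ℤ) + μ q) = 1 := by simp [eParity, hn]
    have hO : oParity ((m : ℤ) + μ q) = 0 := by simp [oParity, hn]
    rw [hE, hO]
    have h1 : ∏ j ∈ Icc 1 ((m+1)/2), (1 * ((μ (2*j-1) : ℚ) + (μ q : ℚ) - 2*j - ((q : ℚ) - m) + m + 1) + 1)
        = ∏ j ∈ SS 1 m, -(w - sh m μ j + 1) := by
      rw [← prod_SS_one']
      apply Finset.prod_congr rfl
      intro j hj
      simp only [mem_Icc] at hj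
      rw [hw]; unfold sh; rw [Nat.cast_sub (by omega)]; push_cast; ring
    have h2 : ∏ j ∈ Icc 1 (m/2), (1 * ((μ (2*j) : ℚ) + (μ q : ℚ) - 2*j - ((q : ℚ) - m) + m + 1) + 1)
        = ∏ j ∈ SN 1 m, -(w - sh m μ j) := by
      rw [SN_one, ← prod_SS_zero']
      apply Finset.prod_congr rfl
      intro j hj
      rw [hw]; unfold sh; push_cast; ring
    rw [h1, h2]
    simp only [zero_mul, zero_add, Finset.prod_const_one, mul_one, div_one]
    rw [mul_div_assoc, prod_neg_div, neg_one_pow_mod]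
    rw [← mul_assoc]
    congr 1
    unfold ef oParity
    simp only [Int.even_iff] at hn ⊢
    by_cases h : m % 2 = 0
    · rw [if_pos (by omega), if_pos h, if_pos trivial, if_neg (by omega), hw]; unfold sh; ring
    · rw [if_neg (by omega), if_neg h, if_pos trivial, if_pos (by omega), hw]; unfold sh; ring

theorem DenomOK_high (c m n p : ℕ) (hc : c = 0 ∨ c = 1) (μ : ℕ → ℤ) (q : ℕ)
    (hq : q ∈ Icc (m+1) (m+n)) (hcq : c = 1 ↔ Even ((m : ℤ) + μ q)) (w : ℚ)
    (hw : w = -(sh m μ q) - 2) (h : AsqDenomOK m n p μ q) :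
    (∀ j ∈ SS c m, w - sh m μ j + 1 ≠ 0) ∧
    (∀ s ∈ (Icc (m+1) (m+n)).erase q, w + sh m μ s + 2 - dl c m μ s ≠ 0) := by
  simp only [mem_Icc] at hq
  unfold AsqDenomOK at h
  rw [if_neg (by omega), Nat.cast_sub (by omega)] at h
  obtain ⟨h1, h2, h3⟩ := h
  constructor
  · intro j hj
    simp only [SS, mem_filter, mem_Icc] at hj
    rw [← neg_ne_zero]
    rcases hc with rfl | rfl
    · have hn : ¬ Even ((m : ℤ) + μ q) := by rw [← hcq]; simp
      have hO : oParity ((m : ℤ) + μ q) = 1 := by simp [oParity, hn]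
      obtain ⟨t, rfl⟩ : ∃ t, j = 2*t := ⟨j/2, by omega⟩
      have h4 := h2 t (by simp only [mem_Icc]; omega)
      rw [hO] at h4
      convert h4 using 1
      rw [hw]; unfold sh; push_cast; ring
    · have hn : Even ((m : ℤ) + μ q) := by rw [← hcq]
      have hE : eParity ((m : ℤ) + μ q) = 1 := by simp [eParity, hn]
      obtain ⟨t, rfl⟩ : ∃ t, j = 2*t+1 := ⟨j/2, by omega⟩
      have h4 := h1 (t+1) (by simp only [mem_Icc]; omega)
      rw [hE, show 2*(t+1)-1 = 2*t+1 by omega] at h4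
      convert h4 using 1
      rw [hw]; unfold sh; push_cast; ring
  · intro s hs
    simp only [mem_erase, mem_Icc] at hs
    have h4 := h3 (s-m) (by simp only [mem_filter, mem_Icc]; omega)
    rw [show m + (s-m) = s by omega, par_relation c m hc μ q hcq, Nat.cast_sub (by omega)] at h4
    convert h4 using 1
    rw [hw]; unfold sh; ring

/-- index set of the poles -/
def II (c m n : ℕ) : Finset ℕ := SS c m ∪ Icc (m+1) (m+n)

/-- the poles -/
def nd (c m : ℕ) (μ ν : ℕ → ℤ) (k : ℕ) : ℚ :=
  if k ≤ m then sh m ν k else -(sh m μ k + 2 - dl c m μ k)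

/-- the numerator polynomial -/
def NP (c m n p : ℕ) (μ ν : ℕ → ℤ) : Polynomial ℚ :=
  (if c = 1 then Polynomial.X - Polynomial.C ((p : ℚ) + m - 1) else 1)
    * (if m % 2 = c then Polynomial.X - Polynomial.C ((n : ℚ) - 1) else 1)
    * (∏ j ∈ SN c m, (Polynomial.X - Polynomial.C (2 * sh m μ j - 1 - sh m ν j)))
    * ∏ s ∈ Icc (m+1) (m+n-1), (Polynomial.X - Polynomial.C (-(sh m ν s) - 1))

theorem NP_eval (c m n p : ℕ) (μ ν : ℕ → ℤ) (w : ℚ) :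
    (NP c m n p μ ν).eval w = ef c m n p w
      * (∏ j ∈ SN c m, (w - (2 * sh m μ j - 1 - sh m ν j)))
      * ∏ s ∈ Icc (m+1) (m+n-1), (w + sh m ν s + 1) := by
  unfold NP ef
  simp only [Polynomial.eval_mul, Polynomial.eval_prod, Polynomial.eval_sub, Polynomial.eval_X,
    Polynomial.eval_C]
  congr 1
  · congr 1
    congr 1 <;> split_ifs <;> simp
  · apply Finset.prod_congr rfl; intros; ring

theorem NP_monic (c m n p : ℕ) (μ ν : ℕ → ℤ) : (NP c m n p μ ν).Monic := by
  unfold NP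
  refine Polynomial.Monic.mul (Polynomial.Monic.mul (Polynomial.Monic.mul ?_ ?_) ?_) ?_
  · split_ifs
    · exact Polynomial.monic_X_sub_C _
    · exact Polynomial.monic_one
  · split_ifs
    · exact Polynomial.monic_X_sub_C _
    · exact Polynomial.monic_one
  · exact Polynomial.monic_prod_of_monic _ _ (fun _ _ => Polynomial.monic_X_sub_C _)
  · exact Polynomial.monic_prod_of_monic _ _ (fun _ _ => Polynomial.monic_X_sub_C _)

theorem NP_next (c m n p : ℕ) (μ ν : ℕ → ℤ) : (NP c m n p μ ν).nextCoeff =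
    -((if c = 1 then ((p : ℚ) + m - 1) else 0) + (if m % 2 = c then ((n : ℚ) - 1) else 0)
      + (∑ j ∈ SN c m, (2 * sh m μ j - 1 - sh m ν j))
      + ∑ s ∈ Icc (m+1) (m+n-1), (-(sh m ν s) - 1)) := by
  unfold NP
  have m1 : (if c = 1 then Polynomial.X - Polynomial.C ((p : ℚ) + m - 1) else 1).Monic := by
    split_ifs
    · exact Polynomial.monic_X_sub_C _
    · exact Polynomial.monic_one
  have m2 : (if m % 2 = c then Polynomial.X - Polynomial.C ((n : ℚ) - 1) else 1).Monic := by
    split_ifs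
    · exact Polynomial.monic_X_sub_C _
    · exact Polynomial.monic_one
  have m3 : (∏ j ∈ SN c m,
      (Polynomial.X - Polynomial.C (2 * sh m μ j - 1 - sh m ν j))).Monic :=
    Polynomial.monic_prod_of_monic _ _ (fun _ _ => Polynomial.monic_X_sub_C _)
  have m4 : (∏ s ∈ Icc (m+1) (m+n-1),
      (Polynomial.X - Polynomial.C (-(sh m ν s) - 1))).Monic :=
    Polynomial.monic_prod_of_monic _ _ (fun _ _ => Polynomial.monic_X_sub_C _)
  rw [((m1.mul m2).mul m3).nextCoeff_mul m4, (m1.mul m2).nextCoeff_mul m3, m1.nextCoeff_mul m2,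
    Polynomial.prod_X_sub_C_nextCoeff, Polynomial.prod_X_sub_C_nextCoeff]
  have one : (1 : Polynomial ℚ).nextCoeff = 0 := by
    rw [← Polynomial.C_1, Polynomial.nextCoeff_C_eq_zero]
  have e1 : (if c = 1 then Polynomial.X - Polynomial.C ((p : ℚ) + m - 1) else 1).nextCoeff
      = -(if c = 1 then ((p : ℚ) + m - 1) else 0) := by
    split_ifs
    · rw [Polynomial.nextCoeff_X_sub_C]
    · rw [one, neg_zero]
  have e2 : (if m % 2 = c then Polynomial.X - Polynomial.C ((n : ℚ) - 1) else 1).nextCoeff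
      = -(if m % 2 = c then ((n : ℚ) - 1) else 0) := by
    split_ifs
    · rw [Polynomial.nextCoeff_X_sub_C]
    · rw [one, neg_zero]
  rw [e1, e2]; ring

theorem card_SS_zero (m : ℕ) : (SS 0 m).card = m / 2 := by
  have h := Finset.card_nbij' (s := Icc 1 (m/2)) (t := SS 0 m) (fun j => 2*j) (fun j => j/2)
    (by intro j hj; simp only [SS, coe_filter, coe_Icc, Set.mem_Icc, mem_Icc, Set.mem_ofPred_eq] at hj ⊢; omega)
    (by intro j hj; simp only [SS, coe_filter, coe_Icc, Set.mem_Icc, mem_Icc, Set.mem_ofPred_eq] at hj ⊢; omega)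
    (by intro j hj; simp only []; omega)
    (by intro j hj; simp only [SS, coe_filter, mem_Icc, Set.mem_ofPred_eq] at hj ⊢; omega)
  rw [← h]; simp

theorem card_SS_one (m : ℕ) : (SS 1 m).card = (m + 1) / 2 := by
  have h := Finset.card_nbij' (s := Icc 1 ((m+1)/2)) (t := SS 1 m) (fun j => 2*j-1)
    (fun j => (j+1)/2)
    (by intro j hj; simp only [SS, coe_filter, coe_Icc, Set.mem_Icc, mem_Icc, Set.mem_ofPred_eq] at hj ⊢; omega)
    (by intro j hj; simp only [SS, coe_filter, coe_Icc, Set.mem_Icc, mem_Icc, Set.mem_ofPred_eq] at hj ⊢; omega)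
    (by intro j hj; simp only [coe_Icc, Set.mem_Icc] at hj ⊢; omega)
    (by intro j hj; simp only [SS, coe_filter, mem_Icc, Set.mem_ofPred_eq] at hj ⊢; omega)
  rw [← h]; simp

theorem II_disj (c m n : ℕ) : Disjoint (SS c m) (Icc (m+1) (m+n)) := by
  rw [Finset.disjoint_left]
  intro j hj
  simp only [SS, mem_filter, mem_Icc] at hj ⊢
  omega

theorem card_II (c m n : ℕ) : (II c m n).card = (SS c m).card + n := by
  unfold II
  rw [Finset.card_union_of_disjoint (II_disj c m n)]
  simp

theorem NP_deg (c m n p : ℕ) (hc : c = 0 ∨ c = 1) (hn : 0 < n) (μ ν : ℕ → ℤ) :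
    (NP c m n p μ ν).natDegree = (II c m n).card := by
  unfold NP
  have m1 : (if c = 1 then Polynomial.X - Polynomial.C ((p : ℚ) + m - 1) else 1).Monic := by
    split_ifs
    · exact Polynomial.monic_X_sub_C _
    · exact Polynomial.monic_one
  have m2 : (if m % 2 = c then Polynomial.X - Polynomial.C ((n : ℚ) - 1) else 1).Monic := by
    split_ifs
    · exact Polynomial.monic_X_sub_C _
    · exact Polynomial.monic_one
  have m3 : (∏ j ∈ SN c m,
      (Polynomial.X - Polynomial.C (2 * sh m μ j - 1 - sh m ν j))).Monic :=
    Polynomial.monic_prod_of_monic _ _ (fun _ _ => Polynomial.monic_X_sub_C _)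
  have m4 : (∏ s ∈ Icc (m+1) (m+n-1),
      (Polynomial.X - Polynomial.C (-(sh m ν s) - 1))).Monic :=
    Polynomial.monic_prod_of_monic _ _ (fun _ _ => Polynomial.monic_X_sub_C _)
  rw [((m1.mul m2).mul m3).natDegree_mul m4, (m1.mul m2).natDegree_mul m3, m1.natDegree_mul m2,
    Polynomial.natDegree_finsetProd_X_sub_C_eq_card,
    Polynomial.natDegree_finsetProd_X_sub_C_eq_card, card_II]
  have e1 : (if c = 1 then Polynomial.X - Polynomial.C ((p : ℚ) + m - 1) else 1).natDegree
      = (if c = 1 then 1 else 0) := by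
    split_ifs
    · rw [Polynomial.natDegree_X_sub_C]
    · exact Polynomial.natDegree_one
  have e2 : (if m % 2 = c then Polynomial.X - Polynomial.C ((n : ℚ) - 1) else 1).natDegree
      = (if m % 2 = c then 1 else 0) := by
    split_ifs
    · rw [Polynomial.natDegree_X_sub_C]
    · exact Polynomial.natDegree_one
  rw [e1, e2, Nat.card_Icc]
  rcases hc with rfl | rfl
  · rw [SN_zero, card_SS_zero, card_SS_one, if_neg (by omega)]
    by_cases h : m % 2 = 0
    · rw [if_pos h]; omega
    · rw [if_neg h]; omega
  · rw [SN_one, card_SS_zero, card_SS_one, if_pos rfl]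
    by_cases h : m % 2 = 1
    · rw [if_pos h]; omega
    · rw [if_neg h]; omega

theorem erase_low (c m n k : ℕ) (hk : k ∈ SS c m) (μ ν : ℕ → ℤ) (w : ℚ) :
    ∏ j ∈ (II c m n).erase k, (w - nd c m μ ν j)
      = (∏ j ∈ (SS c m).erase k, (w - sh m ν j))
        * ∏ s ∈ Icc (m+1) (m+n), (w + sh m μ s + 2 - dl c m μ s) := by
  have hk2 : k ∉ Icc (m+1) (m+n) := Finset.disjoint_left.mp (II_disj c m n) hk
  unfold II
  rw [Finset.erase_union_distrib, Finset.erase_eq_of_notMem hk2, Finset.prod_union]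
  · congr 1
    · apply Finset.prod_congr rfl
      intro j hj
      simp only [SS, mem_erase, mem_filter, mem_Icc] at hj
      unfold nd; rw [if_pos (by omega)]
    · apply Finset.prod_congr rfl
      intro j hj
      simp only [mem_Icc] at hj
      unfold nd; rw [if_neg (by omega)]; ring
  · exact (II_disj c m n).mono_left (Finset.erase_subset _ _)

theorem erase_high (c m n q : ℕ) (hq : q ∈ Icc (m+1) (m+n)) (μ ν : ℕ → ℤ) (w : ℚ) :
    ∏ j ∈ (II c m n).erase q, (w - nd c m μ ν j)
      = (∏ j ∈ SS c m, (w - sh m ν j))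
        * ∏ s ∈ (Icc (m+1) (m+n)).erase q, (w + sh m μ s + 2 - dl c m μ s) := by
  have hk2 : q ∉ SS c m := Finset.disjoint_right.mp (II_disj c m n) hq
  unfold II
  rw [Finset.erase_union_distrib, Finset.erase_eq_of_notMem hk2, Finset.prod_union]
  · congr 1
    · apply Finset.prod_congr rfl
      intro j hj
      simp only [SS, mem_filter, mem_Icc] at hj
      unfold nd; rw [if_pos (by omega)]
    · apply Finset.prod_congr rfl
      intro j hj
      simp only [mem_erase, mem_Icc] at hj
      unfold nd; rw [if_neg (by omega)]; ring
  · exact (II_disj c m n).mono_right (Finset.erase_subset _ _)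

theorem theta_id (w a b : ℚ) (h : a - b = 0 ∨ a - b = 1) (hw : w - b ≠ 0) :
    (w - a + 1) / (w - b) * (w - a) = w - (2 * a - 1 - b) := by
  rw [div_mul_eq_mul_div, div_eq_iff hw]
  rcases h with h | h
  · have : a = b := by linarith
    subst this; ring
  · have : a = b + 1 := by linarith
    subst this; ring

/-- term attached to a pole `k ≤ m` -/
theorem term_low (c m n p : ℕ) (hc : c = 0 ∨ c = 1) (μ ν : ℕ → ℤ) (k : ℕ) (hk : k ∈ SS c m)
    (hθ : ∀ i ∈ Icc 1 m, μ i - ν i = 0 ∨ μ i - ν i = 1)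
    (w : ℚ) (hw : w = sh m ν k)
    (h1 : ∀ j ∈ (Icc 1 m).filter (· ≠ k), w - sh m ν j ≠ 0)
    (h2 : ∀ s ∈ Icc (m+1) (m+n), w + sh m μ s + 2 ≠ 0)
    (h3 : AsqDenomOK m n p (Function.update μ k (ν k)) k) :
    (∏ j ∈ (Icc 1 m).filter (· ≠ k), ((w - sh m μ j + 1) / (w - sh m ν j)))
      * (∏ s ∈ Icc (m+1) (m+n-1), (w + sh m ν s + 1))
      / (∏ s ∈ Icc (m+1) (m+n), (w + sh m μ s + 2))
      * Asq m n p (Function.update μ k (ν k)) k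
    = -((NP c m n p μ ν).eval w / ∏ j ∈ (II c m n).erase k, (w - nd c m μ ν j)) := by
  have hd := DenomOK_low c m n p hc _ k hk h3
  have hk' := hk
  simp only [SS, mem_filter, mem_Icc] at hk'
  have hwk : sh m (Function.update μ k (ν k)) k = w := by
    rw [hw]; unfold sh; simp
  have hsh : ∀ j, j ≠ k → sh m (Function.update μ k (ν k)) j = sh m μ j := by
    intro j hj; unfold sh; rw [Function.update_of_ne hj]
  have hdl : ∀ j, j ≠ k → dl c m (Function.update μ k (ν k)) j = dl c m μ j := by
    intro j hj; unfold dl; rw [Function.update_of_ne hj]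
  rw [Asq_low c m n p hc _ k hk, erase_low c m n k hk, NP_eval, prod_split_ne c m k hk]
  rw [hwk] at hd ⊢
  have hSN : ∀ j ∈ SN c m, j ≠ k ∧ j ∈ Icc 1 m := by
    intro j hj
    simp only [SN, mem_filter] at hj
    refine ⟨?_, hj.1⟩
    rintro rfl; exact hj.2 hk'.2
  have r1 : ∏ j ∈ (SS c m).erase k, (w - sh m (Function.update μ k (ν k)) j)
      = ∏ j ∈ (SS c m).erase k, (w - sh m μ j) :=
    Finset.prod_congr rfl (fun j hj => by rw [hsh j (Finset.ne_of_mem_erase hj)])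
  have r2 : ∏ j ∈ SN c m, (w - sh m (Function.update μ k (ν k)) j)
      = ∏ j ∈ SN c m, (w - sh m μ j) :=
    Finset.prod_congr rfl (fun j hj => by rw [hsh j (hSN j hj).1])
  have r3 : ∏ j ∈ (SS c m).erase k, ((w - sh m (Function.update μ k (ν k)) j)
        * (w - sh m (Function.update μ k (ν k)) j + 1))
      = ∏ j ∈ (SS c m).erase k, ((w - sh m μ j) * (w - sh m μ j + 1)) :=
    Finset.prod_congr rfl (fun j hj => by rw [hsh j (Finset.ne_of_mem_erase hj)])
  have r4 : ∏ s ∈ Icc (m+1) (m+n), ((w + sh m (Function.update μ k (ν k)) s + 2)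
        / (w + sh m (Function.update μ k (ν k)) s + 2 - dl c m (Function.update μ k (ν k)) s))
      = ∏ s ∈ Icc (m+1) (m+n), ((w + sh m μ s + 2) / (w + sh m μ s + 2 - dl c m μ s)) := by
    refine Finset.prod_congr rfl (fun j hj => ?_)
    simp only [mem_Icc] at hj
    rw [hsh j (by omega), hdl j (by omega)]
  rw [r1, r2, r3, r4]
  have k1 : (∏ j ∈ (SS c m).erase k, ((w - sh m μ j + 1) / (w - sh m ν j)))
      * (∏ j ∈ (SS c m).erase k, (w - sh m μ j))
      / (∏ j ∈ (SS c m).erase k, ((w - sh m μ j) * (w - sh m μ j + 1)))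
      = (∏ j ∈ (SS c m).erase k, (w - sh m ν j))⁻¹ := by
    rw [← Finset.prod_mul_distrib, ← Finset.prod_div_distrib, ← Finset.prod_inv_distrib]
    refine Finset.prod_congr rfl (fun j hj => ?_)
    have h := hd j hj
    rw [hsh j (Finset.ne_of_mem_erase hj)] at h
    have ha := h.1
    have hb := h.2
    have hcc : w - sh m ν j ≠ 0 := by
      apply h1
      simp only [SS, mem_erase, mem_filter] at hj ⊢
      exact ⟨hj.2.1, hj.1⟩
    field_simp
  have k2 : (∏ j ∈ SN c m, ((w - sh m μ j + 1) / (w - sh m ν j)))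
      * (∏ j ∈ SN c m, (w - sh m μ j))
      = ∏ j ∈ SN c m, (w - (2 * sh m μ j - 1 - sh m ν j)) := by
    rw [← Finset.prod_mul_distrib]
    refine Finset.prod_congr rfl (fun j hj => ?_)
    have hj' := hSN j hj
    apply theta_id
    · have := hθ j hj'.2
      have e : sh m μ j - sh m ν j = ((μ j - ν j : ℤ) : ℚ) := by unfold sh; push_cast; ring
      rw [e]
      rcases this with h | h <;> rw [h] <;> simp
    · apply h1
      simp only [mem_filter]
      exact ⟨hj'.2, hj'.1⟩
  have k3 : (∏ s ∈ Icc (m+1) (m+n), ((w + sh m μ s + 2) / (w + sh m μ s + 2 - dl c m μ s)))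
      / (∏ s ∈ Icc (m+1) (m+n), (w + sh m μ s + 2))
      = (∏ s ∈ Icc (m+1) (m+n), (w + sh m μ s + 2 - dl c m μ s))⁻¹ := by
    rw [← Finset.prod_div_distrib, ← Finset.prod_inv_distrib]
    refine Finset.prod_congr rfl (fun j hj => ?_)
    have h := h2 j hj
    rw [div_right_comm, div_self h, one_div]
  rw [div_eq_mul_inv _ (_ * _), mul_inv, ← k1, ← k2, ← k3]
  ring

/-- term attached to a pole `q > m`; `α` is the value of `μ q` used in `Asq` -/
theorem term_high (c m n p : ℕ) (hc : c = 0 ∨ c = 1) (μ ν : ℕ → ℤ) (q : ℕ)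
    (hq : q ∈ Icc (m+1) (m+n)) (α : ℤ)
    (hcq : c = 1 ↔ Even ((m : ℤ) + α))
    (hθ : ∀ i ∈ Icc 1 m, μ i - ν i = 0 ∨ μ i - ν i = 1)
    (w : ℚ) (hw : w = -((α : ℚ) + m - q) - 2)
    (h1 : ∀ j ∈ Icc 1 m, w - sh m ν j ≠ 0)
    (h2 : ∀ s ∈ (Icc (m+1) (m+n)).erase q, w + sh m μ s + 2 ≠ 0)
    (h3 : AsqDenomOK m n p (Function.update μ q α) q) :
    (∏ j ∈ Icc 1 m, ((w - sh m μ j + 1) / (w - sh m ν j)))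
      * (∏ s ∈ Icc (m+1) (m+n-1), -(w + sh m ν s + 1))
      / (∏ s ∈ (Icc (m+1) (m+n)).erase q, -(w + sh m μ s + 2))
      * Asq m n p (Function.update μ q α) q
    = -((NP c m n p μ ν).eval w / ∏ j ∈ (II c m n).erase q, (w - nd c m μ ν j)) := by
  have hq' := hq
  simp only [mem_Icc] at hq'
  have hcq' : c = 1 ↔ Even ((m : ℤ) + Function.update μ q α q) := by
    rw [Function.update_self]; exact hcq
  have hwk : w = -(sh m (Function.update μ q α) q) - 2 := by
    rw [hw]; unfold sh; simp
  have hsh : ∀ j, j ≠ q → sh m (Function.update μ q α) j = sh m μ j := by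
    intro j hj; unfold sh; rw [Function.update_of_ne hj]
  have hdl : ∀ j, j ≠ q → dl c m (Function.update μ q α) j = dl c m μ j := by
    intro j hj; unfold dl; rw [Function.update_of_ne hj]
  have hd := (DenomOK_high c m n p hc _ q hq hcq' w hwk h3).1
  rw [Asq_high c m n p hc _ q hq hcq' w hwk, erase_high c m n q hq, NP_eval, prod_split c m]
  have hSN : ∀ j ∈ SN c m, j ≠ q ∧ j ∈ Icc 1 m := by
    intro j hj
    simp only [SN, mem_filter, mem_Icc] at hj ⊢
    omega
  have hSS : ∀ j ∈ SS c m, j ≠ q ∧ j ∈ Icc 1 m := by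
    intro j hj
    simp only [SS, mem_filter, mem_Icc] at hj ⊢
    omega
  have r1 : ∏ j ∈ SS c m, (w - sh m (Function.update μ q α) j + 1)
      = ∏ j ∈ SS c m, (w - sh m μ j + 1) :=
    Finset.prod_congr rfl (fun j hj => by rw [hsh j (hSS j hj).1])
  have r2 : ∏ j ∈ SN c m, (w - sh m (Function.update μ q α) j)
      = ∏ j ∈ SN c m, (w - sh m μ j) :=
    Finset.prod_congr rfl (fun j hj => by rw [hsh j (hSN j hj).1])
  have r4 : ∏ s ∈ (Icc (m+1) (m+n)).erase q, ((w + sh m (Function.update μ q α) s + 2)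
        / (w + sh m (Function.update μ q α) s + 2 - dl c m (Function.update μ q α) s))
      = ∏ s ∈ (Icc (m+1) (m+n)).erase q,
        ((w + sh m μ s + 2) / (w + sh m μ s + 2 - dl c m μ s)) := by
    refine Finset.prod_congr rfl (fun j hj => ?_)
    rw [hsh j (Finset.ne_of_mem_erase hj), hdl j (Finset.ne_of_mem_erase hj)]
  rw [r1, r2, r4]
  have k1 : (∏ j ∈ SS c m, ((w - sh m μ j + 1) / (w - sh m ν j)))
      / (∏ j ∈ SS c m, (w - sh m μ j + 1))
      = (∏ j ∈ SS c m, (w - sh m ν j))⁻¹ := by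
    rw [← Finset.prod_div_distrib, ← Finset.prod_inv_distrib]
    refine Finset.prod_congr rfl (fun j hj => ?_)
    have h := hd j hj
    rw [hsh j (hSS j hj).1] at h
    rw [div_right_comm, div_self h, one_div]
  have k2 : (∏ j ∈ SN c m, ((w - sh m μ j + 1) / (w - sh m ν j)))
      * (∏ j ∈ SN c m, (w - sh m μ j))
      = ∏ j ∈ SN c m, (w - (2 * sh m μ j - 1 - sh m ν j)) := by
    rw [← Finset.prod_mul_distrib]
    refine Finset.prod_congr rfl (fun j hj => ?_)
    have hj' := hSN j hj
    apply theta_id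
    · have := hθ j hj'.2
      have e : sh m μ j - sh m ν j = ((μ j - ν j : ℤ) : ℚ) := by unfold sh; push_cast; ring
      rw [e]
      rcases this with h | h <;> rw [h] <;> simp
    · exact h1 j hj'.2
  have k3 : (∏ s ∈ (Icc (m+1) (m+n)).erase q,
        ((w + sh m μ s + 2) / (w + sh m μ s + 2 - dl c m μ s)))
      / (∏ s ∈ (Icc (m+1) (m+n)).erase q, (w + sh m μ s + 2))
      = (∏ s ∈ (Icc (m+1) (m+n)).erase q, (w + sh m μ s + 2 - dl c m μ s))⁻¹ := by
    rw [← Finset.prod_div_distrib, ← Finset.prod_inv_distrib]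
    refine Finset.prod_congr rfl (fun j hj => ?_)
    have h := h2 j hj
    rw [div_right_comm, div_self h, one_div]
  have k4 : (∏ s ∈ Icc (m+1) (m+n-1), -(w + sh m ν s + 1))
      / (∏ s ∈ (Icc (m+1) (m+n)).erase q, -(w + sh m μ s + 2))
      = (∏ s ∈ Icc (m+1) (m+n-1), (w + sh m ν s + 1))
      / (∏ s ∈ (Icc (m+1) (m+n)).erase q, (w + sh m μ s + 2)) := by
    have hcard : ((Icc (m+1) (m+n)).erase q).card = (Icc (m+1) (m+n-1)).card := by
      rw [Finset.card_erase_of_mem hq, Nat.card_Icc, Nat.card_Icc]; omega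
    have e1 : ∀ (s : Finset ℕ) (f : ℕ → ℚ), ∏ j ∈ s, -(f j) = (-1)^s.card * ∏ j ∈ s, f j := by
      intro s f
      rw [← Finset.prod_const, ← Finset.prod_mul_distrib]
      exact Finset.prod_congr rfl (fun _ _ => by ring)
    rw [e1, e1, hcard]
    apply mul_div_mul_left
    exact pow_ne_zero _ (by norm_num)
  rw [mul_div_assoc, k4, div_eq_mul_inv _ (_ * ∏ s ∈ (Icc (m+1) (m+n)).erase q, _), mul_inv,
    ← k1, ← k2, ← k3]
  ring

theorem nd_high (c m : ℕ) (hc : c = 0 ∨ c = 1) (μ ν : ℕ → ℤ) (q : ℕ) (hq : m < q) (α : ℤ)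
    (hα : α = μ q ∨ α = μ q - 1) (hcq : c = 1 ↔ Even ((m : ℤ) + α)) :
    nd c m μ ν q = -((α : ℚ) + m - q) - 2 := by
  unfold nd dl sh oParity eParity
  rw [if_neg (by omega)]
  simp only [Int.even_iff] at hcq ⊢
  rcases hc with rfl | rfl
  · have : ¬ ((m + α) % 2 = 0) := by rw [← hcq]; simp
    rw [if_neg (by omega)]
    rcases hα with rfl | rfl
    · rw [if_neg this]; ring
    · rw [if_pos (by omega)]; push_cast; ring
  · have : ((m + α) % 2 = 0) := by rw [← hcq]
    rw [if_pos rfl]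
    rcases hα with rfl | rfl
    · rw [if_pos this]; ring
    · rw [if_neg (by omega)]; push_cast; ring

theorem exists_alpha (c m : ℕ) (hc : c = 0 ∨ c = 1) (μ : ℕ → ℤ) (q : ℕ) :
    ∃ α : ℤ, (α = μ q ∨ α = μ q - 1) ∧ (c = 1 ↔ Even ((m : ℤ) + α)) := by
  simp only [Int.even_iff]
  by_cases h : (m + μ q) % 2 = 0
  · rcases hc with rfl | rfl
    · exact ⟨μ q - 1, Or.inr rfl, by omega⟩
    · exact ⟨μ q, Or.inl rfl, by omega⟩
  · rcases hc with rfl | rfl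
    · exact ⟨μ q, Or.inl rfl, by omega⟩
    · exact ⟨μ q - 1, Or.inr rfl, by omega⟩

theorem dl_sum (m : ℕ) (μ : ℕ → ℤ) (s : ℕ) : dl 0 m μ s + dl 1 m μ s = 1 := by
  unfold dl oParity eParity
  by_cases h : Even ((m : ℤ) + μ s) <;> simp [h]

theorem sum_Icc_split (m k : ℕ) (f : ℕ → ℚ) :
    ∑ i ∈ Icc 1 (m+k), f i = ∑ i ∈ Icc 1 m, f i + ∑ i ∈ Icc (m+1) (m+k), f i := by
  rw [← Finset.sum_union]
  · apply Finset.sum_congr _ (fun _ _ => rfl)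
    ext j; simp only [mem_union, mem_Icc]; omega
  · rw [Finset.disjoint_left]; intro j; simp only [mem_Icc]; omega

theorem sum_nd (c m n : ℕ) (μ ν : ℕ → ℤ) :
    ∑ k ∈ II c m n, nd c m μ ν k
      = ∑ k ∈ SS c m, sh m ν k + ∑ s ∈ Icc (m+1) (m+n), -(sh m μ s + 2 - dl c m μ s) := by
  unfold II
  rw [Finset.sum_union (II_disj c m n)]
  congr 1
  · refine Finset.sum_congr rfl (fun j hj => ?_)
    simp only [SS, mem_filter, mem_Icc] at hj
    unfold nd; rw [if_pos (by omega)]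
  · refine Finset.sum_congr rfl (fun j hj => ?_)
    simp only [mem_Icc] at hj
    unfold nd; rw [if_neg (by omega)]

theorem final_sum (m n p : ℕ) (hn : 0 < n) (μ ν : ℕ → ℤ) :
    -((NP 0 m n p μ ν).nextCoeff + ∑ k ∈ II 0 m n, nd 0 m μ ν k)
      + -((NP 1 m n p μ ν).nextCoeff + ∑ k ∈ II 1 m n, nd 1 m μ ν k)
    = (p : ℚ)
      + 2 * ((∑ i ∈ Icc 1 (m+n), (μ i : ℚ)) - ∑ i ∈ Icc 1 (m+n-1), (ν i : ℚ)) := by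
  rw [NP_next, NP_next, sum_nd, sum_nd, SN_zero, SN_one]
  have sp : ∀ f : ℕ → ℚ, ∑ j ∈ SS 0 m, f j + ∑ j ∈ SS 1 m, f j = ∑ j ∈ Icc 1 m, f j := by
    intro f
    rw [← SN_zero]
    exact Finset.sum_filter_add_sum_filter_not _ _ _
  have e1 := sp (fun j => 2 * sh m μ j - 1 - sh m ν j)
  have e2 := sp (fun j => sh m ν j)
  have e3 : ∑ s ∈ Icc (m+1) (m+n), -(sh m μ s + 2 - dl 0 m μ s)
      + ∑ s ∈ Icc (m+1) (m+n), -(sh m μ s + 2 - dl 1 m μ s)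
      = ∑ s ∈ Icc (m+1) (m+n), -(2 * sh m μ s + 3) := by
    rw [← Finset.sum_add_distrib]
    refine Finset.sum_congr rfl (fun j hj => ?_)
    linear_combination dl_sum m μ j
  have e4 : (if m % 2 = 0 then ((n : ℚ) - 1) else 0) + (if m % 2 = 1 then ((n : ℚ) - 1) else 0)
      = (n : ℚ) - 1 := by
    by_cases h : m % 2 = 0
    · rw [if_pos h, if_neg (by omega)]; ring
    · rw [if_neg h, if_pos (by omega)]; ring
  have e5 : ∑ j ∈ Icc 1 m, (2 * sh m μ j - 1 - sh m ν j) - ∑ j ∈ Icc 1 m, sh m ν j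
      = 2 * (∑ j ∈ Icc 1 m, (μ j : ℚ)) - 2 * (∑ j ∈ Icc 1 m, (ν j : ℚ)) - m := by
    have : (m : ℚ) = ∑ j ∈ Icc 1 m, (1 : ℚ) := by simp
    rw [← Finset.sum_sub_distrib, Finset.mul_sum, Finset.mul_sum, ← Finset.sum_sub_distrib]
    nth_rewrite 1 [this]
    rw [← Finset.sum_sub_distrib]
    refine Finset.sum_congr rfl (fun j hj => ?_)
    unfold sh; ring
  obtain ⟨k, rfl⟩ : ∃ k, n = k + 1 := ⟨n - 1, by omega⟩
  have hk : m + (k+1) - 1 = m + k := by omega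
  have e6 : ∑ s ∈ Icc (m+1) (m+(k+1)), -(2 * sh m μ s + 3)
      = ∑ s ∈ Icc (m+1) (m+k), -(2 * sh m μ s + 3)
        - (2 * (μ (m+(k+1)) : ℚ) - 2 * (k+1) + 3) := by
    rw [← Nat.add_assoc, Finset.sum_Icc_succ_top (by omega)]
    unfold sh; push_cast; ring
  have e7 : ∑ s ∈ Icc (m+1) (m+k), -(2 * sh m μ s + 3)
      - 2 * ∑ s ∈ Icc (m+1) (m+k), (-(sh m ν s) - 1)  
      = 2 * ∑ s ∈ Icc (m+1) (m+k), (ν s : ℚ)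
        - 2 * ∑ s ∈ Icc (m+1) (m+k), (μ s : ℚ) - k := by
    have h1 : (k : ℚ) = ∑ j ∈ Icc (m+1) (m+k), (1 : ℚ) := by simp
    rw [Finset.mul_sum, Finset.mul_sum, Finset.mul_sum, ← Finset.sum_sub_distrib,
      ← Finset.sum_sub_distrib]
    nth_rewrite 1 [h1]
    rw [← Finset.sum_sub_distrib]
    refine Finset.sum_congr rfl (fun j hj => ?_)
    unfold sh; ring
  have e8 : ∑ s ∈ Icc (m+1) (m+(k+1)), (μ s : ℚ)
      = ∑ s ∈ Icc (m+1) (m+k), (μ s : ℚ) + μ (m+(k+1)) := by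
    rw [← Nat.add_assoc, Finset.sum_Icc_succ_top (by omega)]
  rw [hk, sum_Icc_split, sum_Icc_split, e8, if_neg (by omega), if_pos rfl]
  push_cast at e4 ⊢
  linarith

/-- the recurrence relation (the diagonal part of
`{c_r^-, c_r^+}|μ) = 2 h_r |μ)`) satisfied by the explicit squared reduced
matrix elements `A_k`.  Here `μ = (μ 1,…,μ (m+n))` and `ν = (ν 1,…,ν (m+n-1))`
are the top two rows of a GZ-pattern, `θ_i = μ i - ν i ∈ {0,1}`, and
`Function.update μ i (μ i - 1)` is the tuple `μ` with `μ_i` lowered by 1.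
Every factor occurring in a denominator is assumed nonzero (for summands whose
prefactor `1-θ_i` resp. `θ_i` vanishes, no assumption is made: such summands
are automatically zero). -/
theorem reduced_matrix_element_recurrence (m n p : ℕ)
    (hm : 0 < m) (hn : 0 < n) (hp : 0 < p) (μ ν : ℕ → ℤ)
    (hμ0 : ∀ i ∈ Finset.Icc 1 (m+n), 0 ≤ μ i)
    (hν0 : ∀ i ∈ Finset.Icc 1 (m+n-1), 0 ≤ ν i)
    (hμdec : ∀ j ∈ Finset.Icc 1 (m+n-1), j ≠ m → μ (j+1) ≤ μ j)
    (hμcard : (((Finset.Icc (m+1) (m+n)).filter fun i => 0 < μ i).card : ℤ) ≤ μ m)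
    (hθ : ∀ i ∈ Finset.Icc 1 m, μ i - ν i = 0 ∨ μ i - ν i = 1)
    (hνdec : ∀ i ∈ Finset.Icc 1 (m-1), ν (i+1) ≤ ν i)
    (hbetween : ∀ s ∈ Finset.Icc (m+1) (m+n-1), μ (s+1) ≤ ν s ∧ ν s ≤ μ s)
    (hνcard : (((Finset.Icc (m+1) (m+n-1)).filter fun i => 0 < ν i).card : ℤ) ≤ ν m)
    (hden1 : ∀ i ∈ Finset.Icc 1 m,
      (μ i = ν i →
        (∀ j ∈ (Finset.Icc 1 m).filter (· ≠ i), (μ i : ℚ) - ν j - i + j ≠ 0) ∧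
        (∀ s ∈ Finset.Icc (m+1) (m+n), (μ i : ℚ) + μ s + 2*m - i - s + 2 ≠ 0) ∧
        AsqDenomOK m n p μ i) ∧
      (μ i = ν i + 1 →
        (∀ j ∈ (Finset.Icc 1 m).filter (· ≠ i), (μ i : ℚ) - ν j - i + j - 1 ≠ 0) ∧
        (∀ s ∈ Finset.Icc (m+1) (m+n), (μ i : ℚ) + μ s + 2*m - i - s + 1 ≠ 0) ∧
        AsqDenomOK m n p (Function.update μ i (μ i - 1)) i))
    (hden2 : ∀ q ∈ Finset.Icc (m+1) (m+n),
      (∀ j ∈ Finset.Icc 1 m, (ν j : ℚ) + μ q + 2*m - j - q + 2 ≠ 0) ∧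
      (∀ s ∈ (Finset.Icc (m+1) (m+n)).filter (· ≠ q), (μ q : ℚ) - μ s - q + s ≠ 0) ∧
      (∀ j ∈ Finset.Icc 1 m, (ν j : ℚ) + μ q + 2*m - j - q + 1 ≠ 0) ∧
      (∀ s ∈ (Finset.Icc (m+1) (m+n)).filter (· ≠ q), (μ q : ℚ) - μ s - q + s - 1 ≠ 0) ∧
      AsqDenomOK m n p μ q ∧ AsqDenomOK m n p (Function.update μ q (μ q - 1)) q) :
    (∑ i ∈ Finset.Icc 1 m,
      (1 - ((μ i - ν i : ℤ) : ℚ))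
        * (∏ j ∈ (Finset.Icc 1 m).filter (· ≠ i),
            (((μ i : ℚ) - μ j - i + j + 1) / ((μ i : ℚ) - ν j - i + j)))
        * (∏ s ∈ Finset.Icc (m+1) (m+n-1), ((μ i : ℚ) + ν s + 2*m - i - s + 1))
        / (∏ s ∈ Finset.Icc (m+1) (m+n), ((μ i : ℚ) + μ s + 2*m - i - s + 2))
        * Asq m n p μ i)
    + (∑ i ∈ Finset.Icc 1 m,
      ((μ i - ν i : ℤ) : ℚ)
        * (∏ j ∈ (Finset.Icc 1 m).filter (· ≠ i),
            (((μ i : ℚ) - μ j - i + j) / ((μ i : ℚ) - ν j - i + j - 1)))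
        * (∏ s ∈ Finset.Icc (m+1) (m+n-1), ((μ i : ℚ) + ν s + 2*m - i - s))
        / (∏ s ∈ Finset.Icc (m+1) (m+n), ((μ i : ℚ) + μ s + 2*m - i - s + 1))
        * Asq m n p (Function.update μ i (μ i - 1)) i)
    + (∑ q ∈ Finset.Icc (m+1) (m+n),
      (∏ j ∈ Finset.Icc 1 m,
          (((μ j : ℚ) + μ q + 2*m - j - q + 1) / ((ν j : ℚ) + μ q + 2*m - j - q + 2)))
        * (∏ s ∈ Finset.Icc (m+1) (m+n-1), ((μ q : ℚ) - ν s - q + s + 1))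
        / (∏ s ∈ (Finset.Icc (m+1) (m+n)).filter (· ≠ q), ((μ q : ℚ) - μ s - q + s))
        * Asq m n p μ q)
    + (∑ q ∈ Finset.Icc (m+1) (m+n),
      (∏ j ∈ Finset.Icc 1 m,
          (((μ j : ℚ) + μ q + 2*m - j - q) / ((ν j : ℚ) + μ q + 2*m - j - q + 1)))
        * (∏ s ∈ Finset.Icc (m+1) (m+n-1), ((μ q : ℚ) - ν s - q + s))
        / (∏ s ∈ (Finset.Icc (m+1) (m+n)).filter (· ≠ q), ((μ q : ℚ) - μ s - q + s - 1))
        * Asq m n p (Function.update μ q (μ q - 1)) q)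
    = (p : ℚ)
      + 2 * ((∑ i ∈ Finset.Icc 1 (m+n), (μ i : ℚ)) - ∑ i ∈ Finset.Icc 1 (m+n-1), (ν i : ℚ)) := by
  classical
  have hb : ∀ i ∈ Icc 1 m, ∀ j ∈ (Icc 1 m).filter (· ≠ i), sh m ν i - sh m ν j ≠ 0 := by
    intro i hi j hj
    rcases hθ i hi with h | h
    · have := ((hden1 i hi).1 (by omega)).1 j hj
      have e : μ i = ν i := by omega
      rw [e] at this
      convert this using 1; unfold sh; ring
    · have := ((hden1 i hi).2 (by omega)).1 j hj
      have e : μ i = ν i + 1 := by omega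
      rw [e] at this
      convert this using 1; unfold sh; push_cast; ring
  have hα0 : ∀ q ∈ Icc (m+1) (m+n), ∀ α : ℤ, (α = μ q ∨ α = μ q - 1) →
      ∀ w : ℚ, w = -((α : ℚ) + m - q) - 2 →
      (∀ j ∈ Icc 1 m, w - sh m ν j ≠ 0) ∧
      (∀ s ∈ (Icc (m+1) (m+n)).erase q, w + sh m μ s + 2 ≠ 0) ∧
      AsqDenomOK m n p (Function.update μ q α) q := by
    intro q hq α hα w hw
    obtain ⟨g1, g2, g3, g4, g5, g6⟩ := hden2 q hq
    rw [filter_ne_erase] at g2 g4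
    rcases hα with rfl | rfl
    · refine ⟨?_, ?_, ?_⟩
      · intro j hj
        rw [← neg_ne_zero]
        convert g1 j hj using 1; rw [hw]; unfold sh; ring
      · intro j hj
        rw [← neg_ne_zero]
        convert g2 j hj using 1; rw [hw]; unfold sh; ring
      · rw [Function.update_eq_self]; exact g5
    · push_cast at hw
      refine ⟨?_, ?_, g6⟩
      · intro j hj
        rw [← neg_ne_zero]
        convert g3 j hj using 1; rw [hw]; unfold sh; ring
      · intro j hj
        rw [← neg_ne_zero]
        convert g4 j hj using 1; rw [hw]; unfold sh; ring
  -- injectivity of the poles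
  have hinj : ∀ c, (c = 0 ∨ c = 1) → Set.InjOn (nd c m μ ν) (II c m n) := by
    intro c hc
    have hlow : ∀ j ∈ SS c m, j ∈ Icc 1 m ∧ nd c m μ ν j = sh m ν j := by
      intro j hj
      simp only [SS, mem_filter] at hj
      refine ⟨hj.1, ?_⟩
      unfold nd; rw [if_pos (mem_Icc.mp hj.1).2]
    have hlh : ∀ j ∈ SS c m, ∀ q ∈ Icc (m+1) (m+n), nd c m μ ν q ≠ nd c m μ ν j := by
      intro j hj q hq heq
      obtain ⟨α, hα, hcq⟩ := exists_alpha c m hc μ q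
      have hw := nd_high c m hc μ ν q (by have := (mem_Icc.mp hq).1; omega) α hα hcq
      have := (hα0 q hq α hα _ hw).1 j (hlow j hj).1
      rw [heq, (hlow j hj).2] at this
      exact this (sub_self _)
    intro i hi j hj hij
    by_contra hne
    simp only [II, coe_union, Set.mem_union, mem_coe] at hi hj
    rcases hi with hi | hi <;> rcases hj with hj | hj
    · apply hb i (hlow i hi).1 j
      · rw [mem_filter]; exact ⟨(hlow j hj).1, fun h => hne h.symm⟩
      · rw [← (hlow i hi).2, ← (hlow j hj).2, hij, sub_self]
    · exact hlh i hi j hj hij.symm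
    · exact hlh j hj i hi hij
    · obtain ⟨α, hα, hcq⟩ := exists_alpha c m hc μ i
      have hw := nd_high c m hc μ ν i (by have := (mem_Icc.mp hi).1; omega) α hα hcq
      have h3 := (hα0 i hi α hα _ hw).2.2
      have h4 := (DenomOK_high c m n p hc (Function.update μ i α) i hi
        (by rw [Function.update_self]; exact hcq) (nd c m μ ν i)
        (by rw [hw]; unfold sh; rw [Function.update_self]) h3).2 j
        (mem_erase.mpr ⟨fun h => hne h.symm, hj⟩)
      have hji : j ≠ i := fun h => hne h.symm
      have e1 : sh m (Function.update μ i α) j = sh m μ j := by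
        unfold sh; rw [Function.update_of_ne hji]
      have e2 : dl c m (Function.update μ i α) j = dl c m μ j := by
        unfold dl; rw [Function.update_of_ne hji]
      rw [e1, e2, hij] at h4
      apply h4
      unfold nd
      rw [if_neg (by have := (mem_Icc.mp hj).1; omega)]
      ring
  have hlag : ∀ c, (c = 0 ∨ c = 1) → ∑ i ∈ II c m n,
      (NP c m n p μ ν).eval (nd c m μ ν i)
        / ∏ j ∈ (II c m n).erase i, (nd c m μ ν i - nd c m μ ν j)
      = (NP c m n p μ ν).nextCoeff + ∑ i ∈ II c m n, nd c m μ ν i := by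
    intro c hc
    apply lagrange_next
    · refine ⟨m+1, ?_⟩
      unfold II; rw [mem_union, mem_Icc]; right; omega
    · exact hinj c hc
    · exact NP_monic _ _ _ _ _ _
    · exact NP_deg _ _ _ _ hc hn _ _
  set Res : ℕ → ℕ → ℚ := fun c i => (NP c m n p μ ν).eval (nd c m μ ν i)
        / ∏ j ∈ (II c m n).erase i, (nd c m μ ν i - nd c m μ ν j) with hRes
  rw [← final_sum m n p hn μ ν, ← hlag 0 (Or.inl rfl), ← hlag 1 (Or.inr rfl)]
  have hsplit : ∀ c, ∑ i ∈ II c m n, Res c i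
      = ∑ i ∈ SS c m, Res c i + ∑ i ∈ Icc (m+1) (m+n), Res c i := by
    intro c
    unfold II
    exact Finset.sum_union (II_disj c m n)
  have hL : ∀ c, (c = 0 ∨ c = 1) → ∀ i ∈ SS c m,
      (1 - ((μ i - ν i : ℤ) : ℚ))
        * (∏ j ∈ (Finset.Icc 1 m).filter (· ≠ i),
            (((μ i : ℚ) - μ j - i + j + 1) / ((μ i : ℚ) - ν j - i + j)))
        * (∏ s ∈ Finset.Icc (m+1) (m+n-1), ((μ i : ℚ) + ν s + 2*m - i - s + 1))
        / (∏ s ∈ Finset.Icc (m+1) (m+n), ((μ i : ℚ) + μ s + 2*m - i - s + 2))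
        * Asq m n p μ i
      + ((μ i - ν i : ℤ) : ℚ)
        * (∏ j ∈ (Finset.Icc 1 m).filter (· ≠ i),
            (((μ i : ℚ) - μ j - i + j) / ((μ i : ℚ) - ν j - i + j - 1)))
        * (∏ s ∈ Finset.Icc (m+1) (m+n-1), ((μ i : ℚ) + ν s + 2*m - i - s))
        / (∏ s ∈ Finset.Icc (m+1) (m+n), ((μ i : ℚ) + μ s + 2*m - i - s + 1))
        * Asq m n p (Function.update μ i (μ i - 1)) i = -Res c i := by
    intro c hc i hi
    have hi' : i ∈ Icc 1 m := (mem_filter.mp hi).1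
    have hnd : nd c m μ ν i = sh m ν i := by
      unfold nd; rw [if_pos (mem_Icc.mp hi').2]
    simp only [hRes, hnd]
    rcases hθ i hi' with h | h
    · have e : ν i = μ i := by omega
      obtain ⟨g1, g2, g3⟩ := (hden1 i hi').1 e.symm
      rw [← term_low c m n p hc μ ν i hi hθ (sh m ν i) rfl (hb i hi')
        (fun s hs => by convert g2 s hs using 1; unfold sh; rw [e]; ring)
        (by rw [e, Function.update_eq_self]; exact g3)]
      rw [h, e, Function.update_eq_self]
      simp only [Int.cast_zero, sub_zero, zero_mul, zero_div, add_zero, one_mul]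
      congr 1
      congr 1
      · congr 1
        · refine Finset.prod_congr rfl (fun j _ => ?_)
          unfold sh; rw [e]; congr 1 <;> ring
        · refine Finset.prod_congr rfl (fun j _ => ?_)
          unfold sh; rw [e]; ring
      · refine Finset.prod_congr rfl (fun j _ => ?_)
        unfold sh; rw [e]; ring
    · have e : ν i = μ i - 1 := by omega
      obtain ⟨g1, g2, g3⟩ := (hden1 i hi').2 (by omega)
      rw [← term_low c m n p hc μ ν i hi hθ (sh m ν i) rfl (hb i hi')
        (fun s hs => by convert g2 s hs using 1; unfold sh; rw [e]; push_cast; ring)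
        (by rw [e]; exact g3)]
      rw [h, e]
      simp only [Int.cast_one, sub_self, zero_mul, zero_div, zero_add, one_mul]
      congr 1
      congr 1
      · congr 1
        · refine Finset.prod_congr rfl (fun j _ => ?_)
          unfold sh; rw [e]; push_cast; congr 1 <;> ring
        · refine Finset.prod_congr rfl (fun j _ => ?_)
          unfold sh; rw [e]; push_cast; ring
      · refine Finset.prod_congr rfl (fun j _ => ?_)
        unfold sh; rw [e]; push_cast; ring
  have hH : ∀ q ∈ Icc (m+1) (m+n), ∀ c, (c = 0 ∨ c = 1) → ∀ α : ℤ, (α = μ q ∨ α = μ q - 1) →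
      (c = 1 ↔ Even ((m : ℤ) + α)) →
      (∏ j ∈ Finset.Icc 1 m,
          (((μ j : ℚ) + α + 2*m - j - q + 1) / ((ν j : ℚ) + α + 2*m - j - q + 2)))
        * (∏ s ∈ Finset.Icc (m+1) (m+n-1), ((α : ℚ) - ν s - q + s + 1))
        / (∏ s ∈ (Finset.Icc (m+1) (m+n)).filter (· ≠ q), ((α : ℚ) - μ s - q + s))
        * Asq m n p (Function.update μ q α) q = -Res c q := by
    intro q hq c hc α hα hcq
    have hw := nd_high c m hc μ ν q (by have := (mem_Icc.mp hq).1; omega) α hα hcq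
    obtain ⟨g1, g2, g3⟩ := hα0 q hq α hα _ hw
    simp only [hRes]
    rw [← term_high c m n p hc μ ν q hq α hcq hθ _ hw g1 g2 g3, filter_ne_erase, hw]
    congr 1
    congr 1
    · congr 1
      · refine Finset.prod_congr rfl (fun j _ => ?_)
        rw [← neg_div_neg_eq]
        unfold sh; congr 1 <;> ring
      · refine Finset.prod_congr rfl (fun j _ => ?_)
        unfold sh; ring
    · refine Finset.prod_congr rfl (fun j _ => ?_)
      unfold sh; ring
  have hH2 : ∀ q ∈ Icc (m+1) (m+n),
      (∏ j ∈ Finset.Icc 1 m,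
          (((μ j : ℚ) + μ q + 2*m - j - q + 1) / ((ν j : ℚ) + μ q + 2*m - j - q + 2)))
        * (∏ s ∈ Finset.Icc (m+1) (m+n-1), ((μ q : ℚ) - ν s - q + s + 1))
        / (∏ s ∈ (Finset.Icc (m+1) (m+n)).filter (· ≠ q), ((μ q : ℚ) - μ s - q + s))
        * Asq m n p μ q
      + (∏ j ∈ Finset.Icc 1 m,
          (((μ j : ℚ) + μ q + 2*m - j - q) / ((ν j : ℚ) + μ q + 2*m - j - q + 1)))
        * (∏ s ∈ Finset.Icc (m+1) (m+n-1), ((μ q : ℚ) - ν s - q + s))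
        / (∏ s ∈ (Finset.Icc (m+1) (m+n)).filter (· ≠ q), ((μ q : ℚ) - μ s - q + s - 1))
        * Asq m n p (Function.update μ q (μ q - 1)) q = -Res 0 q + -Res 1 q := by
    intro q hq
    have key : ∀ c c', (c = 0 ∨ c = 1) → (c' = 0 ∨ c' = 1) →
        (c = 1 ↔ Even ((m : ℤ) + μ q)) → (c' = 1 ↔ Even ((m : ℤ) + (μ q - 1))) →
      (∏ j ∈ Finset.Icc 1 m,
          (((μ j : ℚ) + μ q + 2*m - j - q + 1) / ((ν j : ℚ) + μ q + 2*m - j - q + 2)))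
        * (∏ s ∈ Finset.Icc (m+1) (m+n-1), ((μ q : ℚ) - ν s - q + s + 1))
        / (∏ s ∈ (Finset.Icc (m+1) (m+n)).filter (· ≠ q), ((μ q : ℚ) - μ s - q + s))
        * Asq m n p μ q
      + (∏ j ∈ Finset.Icc 1 m,
          (((μ j : ℚ) + μ q + 2*m - j - q) / ((ν j : ℚ) + μ q + 2*m - j - q + 1)))
        * (∏ s ∈ Finset.Icc (m+1) (m+n-1), ((μ q : ℚ) - ν s - q + s))
        / (∏ s ∈ (Finset.Icc (m+1) (m+n)).filter (· ≠ q), ((μ q : ℚ) - μ s - q + s - 1))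
        * Asq m n p (Function.update μ q (μ q - 1)) q = -Res c q + -Res c' q := by
      intro c c' hc hc' h h'
      rw [← hH q hq c hc (μ q) (Or.inl rfl) h, ← hH q hq c' hc' (μ q - 1) (Or.inr rfl) h',
        Function.update_eq_self]
      congr 1
      congr 1
      congr 1
      · congr 1
        · refine Finset.prod_congr rfl (fun j _ => ?_)
          push_cast; congr 1 <;> ring
        · refine Finset.prod_congr rfl (fun j _ => ?_)
          push_cast; ring
      · refine Finset.prod_congr rfl (fun j _ => ?_)
        push_cast; ring
    simp only [Int.even_iff] at key
    by_cases h : (m + μ q) % 2 = 0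
    · rw [key 1 0 (Or.inr rfl) (Or.inl rfl) (by omega) (by omega)]; ring
    · rw [key 0 1 (Or.inl rfl) (Or.inr rfl) (by omega) (by omega)]
  have hfin : -(∑ i ∈ II 0 m n, Res 0 i) + -(∑ i ∈ II 1 m n, Res 1 i)
      = (∑ i ∈ SS 0 m, -Res 0 i + ∑ i ∈ SS 1 m, -Res 1 i)
        + ∑ q ∈ Icc (m+1) (m+n), (-Res 0 q + -Res 1 q) := by
    rw [hsplit, hsplit, Finset.sum_add_distrib]
    simp only [Finset.sum_neg_distrib]
    ring
  rw [hfin, add_assoc (_ + _), ← Finset.sum_add_distrib, ← Finset.sum_add_distrib,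
    Finset.sum_congr rfl hH2]
  congr 1
  rw [← Finset.sum_congr rfl (hL 0 (Or.inl rfl)), ← Finset.sum_congr rfl (hL 1 (Or.inr rfl)),
    ← SN_zero]
  exact (Finset.sum_filter_add_sum_filter_not _ _ _).symm

end
end
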